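/- arXiv:0901.4800 — 4 statements merged into one kernel-verified Lean document; each statement's English description precedes it below -/
import Mathlib

section
/- Let K ∈ C²((0,∞)², ℝ) be such that for all k ∈ ℕ and all x₁,…,x_k > 0 the matrix (K(x_i,x_j))_{1≤i,j≤k} is symmetric and positive semidefinite, and suppose there is α > 1/2 such that for every x₀ > 0 there is a constant C(x₀) with |∂^{p+q}K/∂x^p∂y^q (x,y)| ≤ C(x₀)/(xy)^α for all x,y ≥ x₀ and all p,q ≥ 0 with p+q ≤ 2. Define ρ_k(x₁,…,x_k) = det(K(x_i,x_j))_{1≤i,j≤k}. Then for every k, ρ_k ∈ C²((0,∞)^k, ℝ); for every x₀ > 0 there is a constant C′(x₀) such that for all k ≥ 1, all x₁,…,x_k ≥ x₀, all p ∈ {0,1,2} and all j ∈ {1,…,k}, |∂^p ρ_k/∂x_j^p (x₁,…,x_k)| ≤ (C′(x₀))^k/(x₁⋯x_k)^{2α}; and ∂^p ρ_k/∂x_j^p (x₁,…,x_k) = 0 whenever p ∈ {0,1}, j ∈ {1,…,k}, and there exists j′ ≠ j with x_j = x_{j′}. -/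
noncomputable section

open Complex MeasureTheory Filter Set

/-- Rising Pochhammer symbol `(x)_n = x(x+1)⋯(x+n−1)`. -/
def poch (x : ℂ) (n : ℕ) : ℂ := ∏ i ∈ Finset.range n, (x + i)

/-- Confluent hypergeometric series `₁F₁[r, q; z]`. -/
def oneF1 (r q z : ℂ) : ℂ := ∑' n : ℕ, poch r n / (poch q n * n.factorial) * z ^ n

/-- Terminating Gauss hypergeometric series `₂F₁[−m, b, c; z]`. -/
def twoF1neg (m : ℕ) (b c z : ℂ) : ℂ :=
  ∑ k ∈ Finset.range (m + 1),
    poch (-(m : ℂ)) k * poch b k / (poch c k * (k.factorial : ℂ)) * z ^ k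

/-- The common prefactor `|2/x|^{Re s} e^{−i/x + π Im(s) Sgn(x)/2}`. -/
def prefac (s : ℂ) (x : ℝ) : ℂ :=
  ((|2 / x| ^ s.re : ℝ) : ℂ) *
    Complex.exp (-Complex.I / (x : ℂ) + ((Real.pi * s.im * Real.sign x / 2 : ℝ) : ℂ))

/-- `P̃(x) = |2/x|^{Re s} e^{−i/x + π Im(s) Sgn(x)/2} ₁F₁[s, 2Re(s)+1; 2i/x]`. -/
def Ptilde (s : ℂ) (x : ℝ) : ℂ :=
  prefac s x * oneF1 s ((2 * s.re + 1 : ℝ) : ℂ) (2 * Complex.I / (x : ℂ))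

/-- `Q(x) = (2/x)|2/x|^{Re s} e^{−i/x + π Im(s) Sgn(x)/2} ₁F₁[s+1, 2Re(s)+2; 2i/x]`. -/
def Qfun (s : ℂ) (x : ℝ) : ℂ :=
  (2 / (x : ℂ)) * prefac s x * oneF1 (s + 1) ((2 * s.re + 2 : ℝ) : ℂ) (2 * Complex.I / (x : ℂ))

/-- The constant in front of the limiting kernel `K_∞`. -/
def cinf (s : ℂ) : ℂ :=
  (1 / (2 * (Real.pi : ℂ))) *
    (Complex.Gamma (s + 1) * Complex.Gamma ((starRingEnd ℂ) s + 1) /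
      (Complex.Gamma ((2 * s.re + 1 : ℝ) : ℂ) * Complex.Gamma ((2 * s.re + 2 : ℝ) : ℂ)))

/-- The limiting kernel `K_∞`, as a complex number (it is in fact real). -/
def KinfC (s : ℂ) (x y : ℝ) : ℂ :=
  if x = y then cinf s * (deriv (Ptilde s) x * Qfun s x - deriv (Qfun s) x * Ptilde s x)
  else cinf s * (Ptilde s x * Qfun s y - Qfun s x * Ptilde s y) / ((x : ℂ) - (y : ℂ))

/-- The limiting kernel `K_∞` (real-valued). -/
def Kinf (s : ℂ) (x y : ℝ) : ℝ := (KinfC s x y).re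

/-- The generalized Cauchy weight `w_H` on `ℝ`. -/
def wH (s : ℂ) (N : ℕ) (x : ℝ) : ℝ :=
  (1 + x ^ 2) ^ (-s.re - (N : ℝ)) * Real.exp (2 * s.im * Complex.arg (1 + Complex.I * x))

/-- The polynomial `p_{N−1}`. -/
def pPrev (s : ℂ) (N : ℕ) (x : ℝ) : ℂ :=
  ((x : ℂ) - Complex.I) ^ (N - 1) *
    twoF1neg (N - 1) (s + 1) ((2 * s.re + 2 : ℝ) : ℂ) (2 / (1 + Complex.I * (x : ℂ)))

/-- The polynomial `p̃_N`. -/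
def pTil (s : ℂ) (N : ℕ) (x : ℝ) : ℂ :=
  ((x : ℂ) - Complex.I) ^ N *
    twoF1neg N s ((2 * s.re + 1 : ℝ) : ℂ) (2 / (1 + Complex.I * (x : ℂ)))

/-- The constant `C_{N,s}`. -/
def CNs (s : ℂ) (N : ℕ) : ℂ :=
  (((2 : ℝ) ^ (2 * s.re) / Real.pi : ℝ) : ℂ) *
    (Complex.Gamma ((2 * s.re + N + 1 : ℝ) : ℂ) * Complex.Gamma (s + 1) *
        Complex.Gamma ((starRingEnd ℂ) s + 1) /
      (Complex.Gamma (N : ℂ) * Complex.Gamma ((2 * s.re + 1 : ℝ) : ℂ) *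
        Complex.Gamma ((2 * s.re + 2 : ℝ) : ℂ)))

def phiN (s : ℂ) (N : ℕ) (x : ℝ) : ℂ := pTil s N x * (Real.sqrt (wH s N x) : ℂ)

def psiN (s : ℂ) (N : ℕ) (x : ℝ) : ℂ := pPrev s N x * (Real.sqrt (wH s N x) : ℂ)

/-- The finite-`N` kernel `K_N` (complex form; extended to the diagonal by continuity,
i.e. by the Bernoulli–l'Hôpital expression). -/
def KNC (s : ℂ) (N : ℕ) (x y : ℝ) : ℂ :=
  if x = y then CNs s N * (deriv (phiN s N) x * psiN s N x - deriv (psiN s N) x * phiN s N x)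
  else CNs s N * (phiN s N x * psiN s N y - psiN s N x * phiN s N y) / ((x : ℂ) - (y : ℂ))

/-- The finite-`N` kernel `K_N` (real-valued). -/
def KN (s : ℂ) (N : ℕ) (x y : ℝ) : ℝ := (KNC s N x y).re

/-- The rescaled kernel `K_[N](x,y) = N · K_N(Nx, Ny)`. -/
def Kscaled (s : ℂ) (N : ℕ) (x y : ℝ) : ℝ := N * KN s N (N * x) (N * y)

/-- `P̃_N`. -/
def PtildeN (s : ℂ) (N : ℕ) (x : ℝ) : ℂ :=
  (((2 : ℝ) ^ s.re : ℝ) : ℂ) *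
    (Real.sqrt (Real.Gamma (2 * s.re + N + 1) / (N * Real.Gamma N)) : ℂ) *
    pTil s N (N * x) * (Real.sqrt (wH s N (N * x)) : ℂ)

/-- `Q_N`. -/
def QN (s : ℂ) (N : ℕ) (x : ℝ) : ℂ :=
  (((2 : ℝ) ^ (s.re + 1) : ℝ) : ℂ) *
    (Real.sqrt (N * Real.Gamma (2 * s.re + N + 1) / Real.Gamma N) : ℂ) *
    pPrev s N (N * x) * (Real.sqrt (wH s N (N * x)) : ℂ)

/-- `k`-point correlation function of a kernel. -/
def rhoK (K : ℝ → ℝ → ℝ) (k : ℕ) (x : Fin k → ℝ) : ℝ :=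
  Matrix.det (Matrix.of fun i j => K (x i) (x j))

/-- The Fredholm determinant of a kernel restricted to `(t,∞)²`. -/
def fredholmDet (K : ℝ → ℝ → ℝ) (t : ℝ) : ℝ :=
  1 + ∑' k : ℕ, ((-1 : ℝ) ^ (k + 1) / (k + 1).factorial) *
    ∫ x : Fin (k + 1) → ℝ in Set.univ.pi fun _ => Set.Ioi t, rhoK K (k + 1) x

/-- Mixed partial derivative `∂^{p+q}K/∂x^p∂y^q`. -/
def pderiv₂ (K : ℝ → ℝ → ℝ) (p q : ℕ) (x y : ℝ) : ℝ :=
  iteratedDeriv p (fun x' => iteratedDeriv q (fun y' => K x' y') y) x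

/-- `F_{n,h,a}(x) = ₂F₁[−n, h, a; 2/(1+ix)]` (a terminating series). -/
def Fnha (n : ℕ) (h : ℂ) (a : ℝ) (x : ℝ) : ℂ :=
  ∑' k : ℕ, poch (-(n : ℂ)) k * poch h k / (poch (a : ℂ) k * (k.factorial : ℂ)) *
    (2 / (1 + Complex.I * (x : ℂ))) ^ k

/-- `θ(τ) = τ (d/dτ) log F(τ⁻¹)`. -/
def thetaOf (F : ℝ → ℝ) (τ : ℝ) : ℝ := τ * deriv (fun u => Real.log (F u⁻¹)) τ

/-- Squared Vandermonde determinant `∏_{j<k} (x_j − x_k)²`. -/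
def vandSq (N : ℕ) (x : Fin N → ℝ) : ℝ :=
  ∏ p ∈ Finset.univ.filter fun p : Fin N × Fin N => p.1 < p.2, (x p.1 - x p.2) ^ 2

/-- `φ(x,y) = (f(x)g(y) − g(x)f(y))/(x−y)`, extended to the diagonal. -/
def phiFG (f g : ℝ → ℝ) (x y : ℝ) : ℝ :=
  if x = y then deriv f x * g x - deriv g x * f x else (f x * g y - g x * f y) / (x - y)

namespace Matrix

variable {n : Type*} [Fintype n] [DecidableEq n]

/-- Expansion of a bordered determinant in terms of the adjugate of the large block. -/
lemma PosSemidef.det_fromBlocks_unique {m : Type*} [Unique m] [Fintype m] [DecidableEq m]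
    {M : Matrix n n ℝ} (hM : M.PosSemidef) (A : Matrix m m ℝ) (B : Matrix m n ℝ)
    (C : Matrix n m ℝ) :
    (fromBlocks A B C M).det = A default default * M.det -
      ∑ i, ∑ l, M.adjugate i l * (B default i * C l default) := by
  have key : ∀ ε : ℝ, 0 < ε → (fromBlocks A B C (M + ε • 1)).det =
      A default default * (M + ε • 1).det -
        ∑ i, ∑ l, (M + ε • 1).adjugate i l * (B default i * C l default) := by
    intro ε hε
    have hpd : (M + ε • (1 : Matrix n n ℝ)).PosDef := PosDef.posSemidef_add hM (PosDef.one.smul hε)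
    have hdet : (M + ε • (1 : Matrix n n ℝ)).det ≠ 0 := hpd.det_pos.ne'
    set N := M + ε • (1 : Matrix n n ℝ)
    let : Invertible N := invertibleOfIsUnitDet N hdet.isUnit
    rw [det_fromBlocks₂₂, det_unique (A - _), invOf_eq_nonsing_inv, inv_def, sub_apply, mul_sub,
      mul_apply, Finset.mul_sum, Finset.sum_comm]
    congr 1
    · ring
    · refine Finset.sum_congr rfl fun i _ => ?_
      rw [mul_apply, Finset.sum_mul, Finset.mul_sum]
      refine Finset.sum_congr rfl fun l _ => ?_
      rw [smul_apply, Ring.inverse_eq_inv', smul_eq_mul]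
      field_simp
  have hc : Continuous fun ε : ℝ => M + ε • (1 : Matrix n n ℝ) := by fun_prop
  have h₁ : Continuous fun ε : ℝ => (fromBlocks A B C (M + ε • 1)).det :=
    (continuous_const.matrix_fromBlocks continuous_const continuous_const hc).matrix_det
  have h₂ : Continuous fun ε : ℝ => A default default * (M + ε • 1).det -
        ∑ i, ∑ l, (M + ε • 1).adjugate i l * (B default i * C l default) := by
    refine (continuous_const.mul hc.matrix_det).sub ?_
    exact continuous_finsetSum _ fun i _ => continuous_finsetSum _ fun l _ =>
      (hc.matrix_adjugate.matrix_elem i l).mul continuous_const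
  have h := tendsto_nhds_unique_of_eventuallyEq (l := nhdsWithin (0 : ℝ) (Set.Ioi 0))
    ((h₁.tendsto 0).mono_left nhdsWithin_le_nhds)
    ((h₂.tendsto 0).mono_left nhdsWithin_le_nhds)
    (eventually_mem_nhdsWithin.mono fun ε hε => key ε hε)
  simpa using h

lemma PosSemidef.prod_eigenvalues_le_exp_trace {M : Matrix n n ℝ} (hM : M.PosSemidef)
    (s : Finset n) : ∏ i ∈ s, hM.1.eigenvalues i ≤ Real.exp M.trace := by
  calc ∏ i ∈ s, hM.1.eigenvalues i ≤ ∏ i ∈ s, Real.exp (hM.1.eigenvalues i) :=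
        Finset.prod_le_prod (fun i _ => hM.eigenvalues_nonneg i)
          fun i _ => by linarith [Real.add_one_le_exp (hM.1.eigenvalues i)]
    _ = Real.exp (∑ i ∈ s, hM.1.eigenvalues i) := (Real.exp_sum _ _).symm
    _ ≤ Real.exp M.trace := by
        have := hM.1.trace_eq_sum_eigenvalues
        simp only [RCLike.ofReal_real_eq_id, id] at this
        rw [this]
        exact Real.exp_le_exp.2 (Finset.sum_le_sum_of_subset_of_nonneg (Finset.subset_univ s)
          fun i _ _ => hM.eigenvalues_nonneg i)

lemma PosSemidef.det_le_exp_trace {M : Matrix n n ℝ} (hM : M.PosSemidef) :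
    M.det ≤ Real.exp M.trace := by
  rw [hM.1.det_eq_prod_eigenvalues]
  exact hM.prod_eigenvalues_le_exp_trace Finset.univ

lemma sum_sq_row_of_mem_unitaryGroup {U : Matrix n n ℝ} (hU : U ∈ unitaryGroup n ℝ) (i : n) :
    ∑ m, U i m ^ 2 = 1 := by
  have h := congrFun (congrFun (mem_unitaryGroup_iff.1 hU) i) i
  rw [mul_apply, one_apply_eq] at h
  rw [← h]
  exact Finset.sum_congr rfl fun m _ => by simp [star_apply, sq]

lemma PosSemidef.abs_adjugate_apply_le_exp_trace {M : Matrix n n ℝ} (hM : M.PosSemidef)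
    (i l : n) : |M.adjugate i l| ≤ Real.exp M.trace := by
  set U : Matrix n n ℝ := (hM.1.eigenvectorUnitary : Matrix n n ℝ)
  set μ : n → ℝ := fun m => ∏ k ∈ Finset.univ.erase m, hM.1.eigenvalues k
  have hUmem : U ∈ unitaryGroup n ℝ := hM.1.eigenvectorUnitary.2
  have hspec : M = U * diagonal hM.1.eigenvalues * star U := by
    have := hM.1.spectral_theorem
    rw [Unitary.conjStarAlgAut_apply] at this
    simpa [Function.comp_def] using this
  have hdet : U.det * (star U).det = 1 := by
    rw [← det_mul, mem_unitaryGroup_iff.1 hUmem, det_one]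
  have hadjU : U.adjugate = U.det • star U := by
    calc U.adjugate = U.adjugate * (U * star U) := by
          rw [mem_unitaryGroup_iff.1 hUmem, Matrix.mul_one]
      _ = U.det • star U := by
          rw [← Matrix.mul_assoc, adjugate_mul, Matrix.smul_mul, Matrix.one_mul]
  have hadjS : (star U).adjugate = (star U).det • U := by
    calc (star U).adjugate = (star U).adjugate * (star U * U) := by
          rw [mem_unitaryGroup_iff'.1 hUmem, Matrix.mul_one]
      _ = (star U).det • U := by
          rw [← Matrix.mul_assoc, adjugate_mul, Matrix.smul_mul, Matrix.one_mul]
  have hadj : M.adjugate = U * diagonal μ * star U := by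
    conv_lhs => rw [hspec]
    rw [adjugate_mul_distrib, adjugate_mul_distrib, hadjU, hadjS, adjugate_diagonal,
      Matrix.smul_mul, Matrix.mul_smul, Matrix.mul_smul, smul_smul, mul_comm (star U).det, hdet,
      one_smul, Matrix.mul_assoc]
  have hμ0 : ∀ m, 0 ≤ μ m := fun m => Finset.prod_nonneg fun k _ => hM.eigenvalues_nonneg k
  have hμle : ∀ m, μ m ≤ Real.exp M.trace := fun m => hM.prod_eigenvalues_le_exp_trace _
  calc |M.adjugate i l| = |∑ m, U i m * μ m * U l m| := by
        rw [hadj, mul_apply]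
        simp [mul_diagonal, star_apply]
    _ ≤ ∑ m, |U i m * μ m * U l m| := Finset.abs_sum_le_sum_abs _ _
    _ ≤ ∑ m, Real.exp M.trace * ((U i m ^ 2 + U l m ^ 2) / 2) := by
        refine Finset.sum_le_sum fun m _ => ?_
        rw [abs_mul, abs_mul, abs_of_nonneg (hμ0 m)]
        calc |U i m| * μ m * |U l m| = μ m * (|U i m| * |U l m|) := by ring
          _ ≤ Real.exp M.trace * ((U i m ^ 2 + U l m ^ 2) / 2) := by
            refine mul_le_mul (hμle m) ?_ (by positivity) (Real.exp_pos _).le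
            nlinarith [sq_nonneg (|U i m| - |U l m|), sq_abs (U i m), sq_abs (U l m)]
    _ = Real.exp M.trace := by
        rw [← Finset.mul_sum, ← Finset.sum_div, Finset.sum_add_distrib,
          sum_sq_row_of_mem_unitaryGroup hUmem, sum_sq_row_of_mem_unitaryGroup hUmem]
        norm_num

lemma PosSemidef.diagonal_mul_mul_diagonal {M : Matrix n n ℝ} (hM : M.PosSemidef) (d : n → ℝ) :
    (diagonal d * M * diagonal d).PosSemidef := by
  simpa [diagonal_conjTranspose] using hM.conjTranspose_mul_mul_same (diagonal d)

lemma trace_diagonal_mul_mul_diagonal_le {M : Matrix n n ℝ} {d : n → ℝ} {C : ℝ}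
    (hd : ∀ i, 0 < d i) (hC : ∀ i, M i i ≤ C / (d i * d i)) :
    (diagonal d * M * diagonal d).trace ≤ Fintype.card n * C := by
  calc (diagonal d * M * diagonal d).trace = ∑ i, d i * M i i * d i := by simp [trace]
    _ ≤ ∑ _i : n, C := by
        refine Finset.sum_le_sum fun i _ => ?_
        have := (le_div_iff₀ (mul_pos (hd i) (hd i))).1 (hC i)
        linarith
    _ = Fintype.card n * C := by simp

lemma PosSemidef.det_le_of_diag_le {M : Matrix n n ℝ} (hM : M.PosSemidef) {d : n → ℝ} {C : ℝ}
    (hd : ∀ i, 0 < d i) (hC : ∀ i, M i i ≤ C / (d i * d i)) :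
    M.det ≤ Real.exp (Fintype.card n * C) / (∏ i, d i) ^ 2 := by
  have h := (hM.diagonal_mul_mul_diagonal d).det_le_exp_trace.trans
    (Real.exp_le_exp.2 (trace_diagonal_mul_mul_diagonal_le hd hC))
  rw [det_mul, det_mul, det_diagonal] at h
  rw [le_div_iff₀ (pow_pos (Finset.prod_pos fun i _ => hd i) 2)]
  linarith

lemma PosSemidef.abs_adjugate_apply_le_of_diag_le {M : Matrix n n ℝ} (hM : M.PosSemidef)
    {d : n → ℝ} {C : ℝ} (hd : ∀ i, 0 < d i) (hC : ∀ i, M i i ≤ C / (d i * d i)) (i l : n) :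
    |M.adjugate i l| ≤ Real.exp (Fintype.card n * C) * (d i * d l) / (∏ i, d i) ^ 2 := by
  set D : Matrix n n ℝ := diagonal d
  have hP : 0 < (∏ i, d i) ^ 2 := pow_pos (Finset.prod_pos fun i _ => hd i) 2
  have h := ((hM.diagonal_mul_mul_diagonal d).abs_adjugate_apply_le_exp_trace i l).trans
    (Real.exp_le_exp.2 (trace_diagonal_mul_mul_diagonal_le hd hC))
  have hD : D.det = ∏ i, d i := det_diagonal
  have hmat : D * (D * M * D).adjugate * D = (∏ i, d i) ^ 2 • M.adjugate := by
    calc D * (D * M * D).adjugate * D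
        = (D * D.adjugate) * M.adjugate * (D.adjugate * D) := by
          simp only [adjugate_mul_distrib, Matrix.mul_assoc]
      _ = (∏ i, d i) ^ 2 • M.adjugate := by
          rw [mul_adjugate, adjugate_mul, hD, Matrix.smul_mul, Matrix.one_mul, Matrix.mul_smul,
            Matrix.mul_one, smul_smul, sq]
  have hentry : d i * (D * M * D).adjugate i l * d l = (∏ i, d i) ^ 2 * M.adjugate i l := by
    have := congrFun (congrFun hmat i) l
    simpa [D] using this
  rw [le_div_iff₀ hP]
  calc |M.adjugate i l| * (∏ i, d i) ^ 2 = |(∏ i, d i) ^ 2 * M.adjugate i l| := by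
        rw [abs_mul, abs_of_pos hP, mul_comm]
    _ = d i * d l * |(D * M * D).adjugate i l| := by
        rw [← hentry, abs_mul, abs_mul, abs_of_pos (hd i), abs_of_pos (hd l)]; ring
    _ ≤ d i * d l * Real.exp (Fintype.card n * C) :=
        mul_le_mul_of_nonneg_left h (mul_pos (hd i) (hd l)).le
    _ = Real.exp (Fintype.card n * C) * (d i * d l) := mul_comm _ _

end Matrix

lemma hasDerivAt_diagonal {H : ℝ × ℝ → ℝ} {u : ℝ} (hH : DifferentiableAt ℝ H (u, u)) :
    HasDerivAt (fun t => H (t, t))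
      (deriv (fun t => H (t, u)) u + deriv (fun t => H (u, t)) u) u := by
  have h₁ : HasDerivAt (fun t => H (t, u)) (fderiv ℝ H (u, u) (1, 0)) u :=
    hH.hasFDerivAt.comp_hasDerivAt (f := fun t => (t, u)) u
      ((hasDerivAt_id u).prodMk (hasDerivAt_const u u))
  have h₂ : HasDerivAt (fun t => H (u, t)) (fderiv ℝ H (u, u) (0, 1)) u :=
    hH.hasFDerivAt.comp_hasDerivAt u ((hasDerivAt_const u u).prodMk (hasDerivAt_id u))
  have h₃ : HasDerivAt (fun t => H (t, t)) (fderiv ℝ H (u, u) (1, 1)) u :=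
    hH.hasFDerivAt.comp_hasDerivAt (f := fun t => (t, t)) u
      ((hasDerivAt_id u).prodMk (hasDerivAt_id u))
  rw [h₁.deriv, h₂.deriv, ← map_add]
  simpa using h₃

section Kernel

variable {K : ℝ → ℝ → ℝ}

lemma contDiffAt_uncurry_of_pos
    (hK : ContDiffOn ℝ 2 (Function.uncurry K) (Set.Ioi 0 ×ˢ Set.Ioi 0)) {x y : ℝ}
    (hx : 0 < x) (hy : 0 < y) : ContDiffAt ℝ 2 (Function.uncurry K) (x, y) :=
  hK.contDiffAt ((isOpen_Ioi.prod isOpen_Ioi).mem_nhds ⟨hx, hy⟩)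

lemma differentiableAt_pderiv₂_zero_one
    (hK : ContDiffOn ℝ 2 (Function.uncurry K) (Set.Ioi 0 ×ˢ Set.Ioi 0)) {x y : ℝ}
    (hx : 0 < x) (hy : 0 < y) :
    DifferentiableAt ℝ (Function.uncurry (pderiv₂ K 0 1)) (x, y) := by
  have hev : Function.uncurry (pderiv₂ K 0 1) =ᶠ[nhds (x, y)]
      fun q => fderiv ℝ (Function.uncurry K) q (0, 1) := by
    filter_upwards [(isOpen_Ioi.prod isOpen_Ioi).mem_nhds (show (x, y) ∈ Set.Ioi 0 ×ˢ Set.Ioi 0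
      from ⟨hx, hy⟩)] with q hq
    have hd : DifferentiableAt ℝ (Function.uncurry K) (q.1, q.2) :=
      (contDiffAt_uncurry_of_pos hK hq.1 hq.2).differentiableAt (by norm_num)
    have h : HasDerivAt (fun t => K q.1 t) (fderiv ℝ (Function.uncurry K) (q.1, q.2) (0, 1)) q.2 :=
      hd.hasFDerivAt.comp_hasDerivAt q.2
        ((hasDerivAt_const q.2 q.1).prodMk (hasDerivAt_id q.2))
    simpa [Function.uncurry, pderiv₂, iteratedDeriv_one] using h.deriv
  refine DifferentiableAt.congr_of_eventuallyEq ?_ hev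
  have h : ContDiffAt ℝ 1 (fderiv ℝ (Function.uncurry K)) (x, y) :=
    (contDiffAt_uncurry_of_pos hK hx hy).fderiv_right (by norm_num)
  exact (h.differentiableAt (by norm_num)).clm_apply (differentiableAt_const _)

lemma contDiffAt_right_of_pos
    (hK : ContDiffOn ℝ 2 (Function.uncurry K) (Set.Ioi 0 ×ˢ Set.Ioi 0)) {x y : ℝ}
    (hx : 0 < x) (hy : 0 < y) : ContDiffAt ℝ 2 (fun t => K x t) y :=
  (contDiffAt_uncurry_of_pos hK hx hy).comp y (contDiffAt_const.prodMk contDiffAt_id)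

lemma contDiffAt_diagonal_of_pos
    (hK : ContDiffOn ℝ 2 (Function.uncurry K) (Set.Ioi 0 ×ˢ Set.Ioi 0)) {u : ℝ} (hu : 0 < u) :
    ContDiffAt ℝ 2 (fun t => K t t) u :=
  ContDiffAt.comp u (g := Function.uncurry K) (f := fun t => (t, t))
    (contDiffAt_uncurry_of_pos hK hu hu) (contDiffAt_id.prodMk contDiffAt_id)

lemma deriv_kernel_diagonal
    (hK : ContDiffOn ℝ 2 (Function.uncurry K) (Set.Ioi 0 ×ˢ Set.Ioi 0))
    (hsymm : ∀ x y, 0 < x → 0 < y → K x y = K y x) {u : ℝ} (hu : 0 < u) :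
    deriv (fun t => K t t) u = 2 * pderiv₂ K 0 1 u u := by
  have hd : DifferentiableAt ℝ (Function.uncurry K) (u, u) :=
    (contDiffAt_uncurry_of_pos hK hu hu).differentiableAt (by norm_num)
  have h := (hasDerivAt_diagonal hd).deriv
  simp only [Function.uncurry_apply_pair] at h
  have hs : (fun t => K t u) =ᶠ[nhds u] fun t => K u t := by
    filter_upwards [lt_mem_nhds hu] with t ht using hsymm t u ht hu
  rw [h, hs.deriv_eq, pderiv₂, iteratedDeriv_zero, iteratedDeriv_one, two_mul]

lemma iteratedDeriv_two_kernel_diagonal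
    (hK : ContDiffOn ℝ 2 (Function.uncurry K) (Set.Ioi 0 ×ˢ Set.Ioi 0))
    (hsymm : ∀ x y, 0 < x → 0 < y → K x y = K y x) {u : ℝ} (hu : 0 < u) :
    iteratedDeriv 2 (fun t => K t t) u = 2 * (pderiv₂ K 1 1 u u + pderiv₂ K 0 2 u u) := by
  have hev : deriv (fun t => K t t) =ᶠ[nhds u] fun t => 2 * pderiv₂ K 0 1 t t := by
    filter_upwards [lt_mem_nhds hu] with t ht using deriv_kernel_diagonal hK hsymm ht
  have h := hasDerivAt_diagonal (differentiableAt_pderiv₂_zero_one hK hu hu)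
  simp only [Function.uncurry_apply_pair] at h
  rw [iteratedDeriv_succ', iteratedDeriv_one, hev.deriv_eq, (h.const_mul 2).deriv]
  simp only [pderiv₂, iteratedDeriv_succ', iteratedDeriv_zero]

lemma abs_iteratedDeriv_kernel_diagonal_le
    (hK : ContDiffOn ℝ 2 (Function.uncurry K) (Set.Ioi 0 ×ˢ Set.Ioi 0))
    (hsymm : ∀ x y, 0 < x → 0 < y → K x y = K y x) {u B : ℝ} (hu : 0 < u)
    (hB : ∀ p q : ℕ, p + q ≤ 2 → |pderiv₂ K p q u u| ≤ B) {p : ℕ} (hp : p ≤ 2) :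
    |iteratedDeriv p (fun t => K t t) u| ≤ 4 * B := by
  have h₀₀ := hB 0 0 (by norm_num)
  have hB0 : 0 ≤ B := (abs_nonneg _).trans h₀₀
  interval_cases p
  · simp only [pderiv₂, iteratedDeriv_zero] at h₀₀ ⊢
    linarith
  · rw [iteratedDeriv_one, deriv_kernel_diagonal hK hsymm hu, abs_mul, abs_two]
    linarith [hB 0 1 (by norm_num)]
  · rw [iteratedDeriv_two_kernel_diagonal hK hsymm hu, abs_mul, abs_two]
    linarith [hB 1 1 (by norm_num), hB 0 2 (by norm_num),
      abs_add_le (pderiv₂ K 1 1 u u) (pderiv₂ K 0 2 u u)]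

lemma contDiffOn_rhoK
    (hK : ContDiffOn ℝ 2 (Function.uncurry K) (Set.Ioi 0 ×ˢ Set.Ioi 0)) (k : ℕ) :
    ContDiffOn ℝ 2 (rhoK K k) {x : Fin k → ℝ | ∀ i, 0 < x i} := by
  intro x hx
  refine ContDiffAt.contDiffWithinAt ?_
  have hentry : ∀ i l, ContDiffAt ℝ 2 (fun x : Fin k → ℝ => K (x i) (x l)) x := fun i l =>
    ContDiffAt.comp x (g := Function.uncurry K) (f := fun x : Fin k → ℝ => (x i, x l))
      (contDiffAt_uncurry_of_pos hK (hx i) (hx l))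
      ((contDiff_apply ℝ ℝ i).contDiffAt.prodMk (contDiff_apply ℝ ℝ l).contDiffAt)
  have hrho : rhoK K k = fun x => ∑ σ : Equiv.Perm (Fin k),
      ((Equiv.Perm.sign σ : ℤ) : ℝ) * ∏ i, K (x (σ i)) (x i) := by
    funext x
    simp [rhoK, Matrix.det_apply']
  rw [hrho]
  exact ContDiffAt.sum fun σ _ => contDiffAt_const.mul (contDiffAt_prod fun i _ => hentry _ _)

/-- The Gram matrix of the kernel at all the points but the `j`-th one. -/
def gramCompl (K : ℝ → ℝ → ℝ) {k : ℕ} (x : Fin k → ℝ) (j : Fin k) :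
    Matrix {i // ¬ i = j} {i // ¬ i = j} ℝ :=
  Matrix.of fun i l => K (x i) (x l)

lemma posSemidef_gramCompl
    (hpos : ∀ (k : ℕ) (x : Fin k → ℝ), (∀ i, 0 < x i) →
      (Matrix.of fun i j => K (x i) (x j)).PosSemidef)
    {k : ℕ} {x : Fin k → ℝ} (hx : ∀ i, 0 < x i) (j : Fin k) : (gramCompl K x j).PosSemidef :=
  (hpos k x hx).submatrix Subtype.val

lemma rhoK_update
    (hpos : ∀ (k : ℕ) (x : Fin k → ℝ), (∀ i, 0 < x i) →
      (Matrix.of fun i j => K (x i) (x j)).PosSemidef)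
    (hsymm : ∀ x y, 0 < x → 0 < y → K x y = K y x)
    {k : ℕ} {x : Fin k → ℝ} (hx : ∀ i, 0 < x i) (j : Fin k) {u : ℝ} (hu : 0 < u) :
    rhoK K k (Function.update x j u) = K u u * (gramCompl K x j).det -
      ∑ i, ∑ l, (gramCompl K x j).adjugate i l * (K (x i) u * K (x l) u) := by
  set A : Matrix (Fin k) (Fin k) ℝ :=
    Matrix.of fun i l => K (Function.update x j u i) (Function.update x j u l) with hA
  set A' := A.submatrix (Equiv.sumCompl (· = j)) (Equiv.sumCompl (· = j)) with hA'
  have h₂₂ : A'.toBlocks₂₂ = gramCompl K x j := by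
    ext i l
    simp [hA', hA, Matrix.toBlocks₂₂, gramCompl, Function.update_of_ne i.2,
      Function.update_of_ne l.2]
  have hdet : rhoK K k (Function.update x j u) = A'.det :=
    (Matrix.det_submatrix_equiv_self _ A).symm
  rw [hdet, ← Matrix.fromBlocks_toBlocks A', h₂₂,
    (posSemidef_gramCompl hpos hx j).det_fromBlocks_unique]
  have hdef : ((default : {i // i = j}) : Fin k) = j := (default : {i // i = j}).2
  congr 1
  · simp [hA', hA, Matrix.toBlocks₁₁, hdef]
  · refine Finset.sum_congr rfl fun i _ => Finset.sum_congr rfl fun l _ => ?_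
    simp [hA', hA, Matrix.toBlocks₁₂, Matrix.toBlocks₂₁, hdef, Function.update_of_ne i.2,
      Function.update_of_ne l.2, hsymm u (x i) hu (hx i)]

lemma abs_iteratedDeriv_mul_le {f g : ℝ → ℝ} {u a b : ℝ} {p : ℕ} (hf : ContDiffAt ℝ p f u)
    (hg : ContDiffAt ℝ p g u) (hfa : ∀ m ≤ p, |iteratedDeriv m f u| ≤ a)
    (hgb : ∀ m ≤ p, |iteratedDeriv m g u| ≤ b) :
    |iteratedDeriv p (fun t => f t * g t) u| ≤ 2 ^ p * (a * b) := by
  have ha : 0 ≤ a := (abs_nonneg _).trans (hfa 0 (Nat.zero_le _))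
  rw [iteratedDeriv_fun_mul hf hg]
  refine (Finset.abs_sum_le_sum_abs _ _).trans ?_
  calc ∑ i ∈ Finset.range (p + 1),
        |(p.choose i : ℝ) * iteratedDeriv i f u * iteratedDeriv (p - i) g u|
      ≤ ∑ i ∈ Finset.range (p + 1), (p.choose i : ℝ) * (a * b) := by
        refine Finset.sum_le_sum fun i hi => ?_
        rw [abs_mul, abs_mul, Nat.abs_cast, mul_assoc]
        exact mul_le_mul_of_nonneg_left (mul_le_mul (hfa i (Nat.lt_succ_iff.1
          (Finset.mem_range.1 hi))) (hgb _ (Nat.sub_le _ _)) (abs_nonneg _) ha)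
          (Nat.cast_nonneg _)
    _ = 2 ^ p * (a * b) := by
        rw [← Finset.sum_mul]
        congr 1
        exact_mod_cast Nat.sum_range_choose p

lemma iteratedDeriv_rhoK_update
    (hK : ContDiffOn ℝ 2 (Function.uncurry K) (Set.Ioi 0 ×ˢ Set.Ioi 0))
    (hpos : ∀ (k : ℕ) (x : Fin k → ℝ), (∀ i, 0 < x i) →
      (Matrix.of fun i j => K (x i) (x j)).PosSemidef)
    (hsymm : ∀ x y, 0 < x → 0 < y → K x y = K y x)
    {k : ℕ} {x : Fin k → ℝ} (hx : ∀ i, 0 < x i) (j : Fin k) {u : ℝ} (hu : 0 < u)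
    {p : ℕ} (hp : p ≤ 2) :
    iteratedDeriv p (fun t => rhoK K k (Function.update x j t)) u =
      iteratedDeriv p (fun t => K t t) u * (gramCompl K x j).det -
        ∑ i, ∑ l, (gramCompl K x j).adjugate i l *
          iteratedDeriv p (fun t => K (x i) t * K (x l) t) u := by
  have hev : (fun t => rhoK K k (Function.update x j t)) =ᶠ[nhds u]
      (fun t => K t t * (gramCompl K x j).det) -
        ∑ i, ∑ l, fun t => (gramCompl K x j).adjugate i l * (K (x i) t * K (x l) t) := by
    filter_upwards [lt_mem_nhds hu] with t ht
    simp only [Pi.sub_apply, Finset.sum_apply]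
    exact rhoK_update hpos hsymm hx j ht
  have hp' : (p : WithTop ℕ∞) ≤ 2 := by exact_mod_cast hp
  have hg : ∀ i, ContDiffAt ℝ p (fun t => K (x i) t) u := fun i =>
    (contDiffAt_right_of_pos hK (hx i) hu).of_le hp'
  have hterm : ∀ i l : {i // ¬ i = j}, ContDiffAt ℝ p
      (fun t => (gramCompl K x j).adjugate i l * (K (x i) t * K (x l) t)) u := fun i l =>
    contDiffAt_const.mul ((hg i).mul (hg l))
  have hrow : ∀ i : {i // ¬ i = j}, ContDiffAt ℝ p
      (∑ l, fun t => (gramCompl K x j).adjugate i l * (K (x i) t * K (x l) t)) u := fun i => by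
    rw [Finset.sum_fn]
    exact ContDiffAt.sum fun l _ => hterm i l
  have hall : ContDiffAt ℝ p
      (∑ i, ∑ l, fun t => (gramCompl K x j).adjugate i l * (K (x i) t * K (x l) t)) u := by
    rw [Finset.sum_fn]
    exact ContDiffAt.sum fun i _ => hrow i
  rw [hev.iteratedDeriv_eq, iteratedDeriv_sub
    (((contDiffAt_diagonal_of_pos hK hu).of_le hp').mul contDiffAt_const) hall,
    iteratedDeriv_mul_const_field, iteratedDeriv_sum fun i _ => hrow i]
  congr 1
  refine Finset.sum_congr rfl fun i _ => ?_
  rw [iteratedDeriv_sum fun l _ => hterm i l]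
  exact Finset.sum_congr rfl fun l _ => iteratedDeriv_const_mul_field _ _

lemma natCast_sq_le_four_pow (k : ℕ) : (k : ℝ) ^ 2 ≤ 4 ^ k := by
  have h : (k : ℝ) ≤ 2 ^ k := by exact_mod_cast Nat.lt_two_pow_self.le
  calc (k : ℝ) ^ 2 ≤ (2 ^ k) ^ 2 := pow_le_pow_left₀ (Nat.cast_nonneg k) h 2
    _ = 4 ^ k := by rw [← pow_mul, mul_comm, pow_mul]; norm_num

lemma four_mul_add_le_pow {C : ℝ} (hC : 0 ≤ C) {k : ℕ} (hk : 1 ≤ k) :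
    4 * C + k ^ 2 * (4 * C ^ 2) ≤ (16 * (1 + C) ^ 2) ^ k := by
  have hk1 : (1 : ℝ) ≤ k ^ 2 := one_le_pow₀ (by exact_mod_cast hk)
  calc 4 * C + k ^ 2 * (4 * C ^ 2) ≤ k ^ 2 * (4 * (1 + C) ^ 2) := by
        nlinarith [mul_nonneg (sub_nonneg.2 hk1) hC]
    _ ≤ 4 ^ k * (4 * (1 + C) ^ 2) ^ k := by
        refine mul_le_mul (natCast_sq_le_four_pow k) (le_self_pow₀ ?_ (by omega))
          (by positivity) (by positivity)
        nlinarith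
    _ = (16 * (1 + C) ^ 2) ^ k := by rw [← mul_pow]; ring

lemma abs_iteratedDeriv_rhoK_update_le
    (hK : ContDiffOn ℝ 2 (Function.uncurry K) (Set.Ioi 0 ×ˢ Set.Ioi 0))
    (hpos : ∀ (k : ℕ) (x : Fin k → ℝ), (∀ i, 0 < x i) →
      (Matrix.of fun i j => K (x i) (x j)).PosSemidef)
    (hsymm : ∀ x y, 0 < x → 0 < y → K x y = K y x)
    {α C x₀ : ℝ} (hC0 : 0 ≤ C) (hx₀ : 0 < x₀)
    (hC : ∀ p q : ℕ, p + q ≤ 2 →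
      ∀ x y : ℝ, x₀ ≤ x → x₀ ≤ y → |pderiv₂ K p q x y| ≤ C / (x * y) ^ α)
    {k : ℕ} (hk : 1 ≤ k) {x : Fin k → ℝ} (hx : ∀ i, x₀ ≤ x i) (j : Fin k)
    {p : ℕ} (hp : p ≤ 2) :
    |iteratedDeriv p (fun u => rhoK K k (Function.update x j u)) (x j)| ≤
      (Real.exp C * (16 * (1 + C) ^ 2)) ^ k / (∏ i, x i) ^ (2 * α) := by
  have hx0 : ∀ i, 0 < x i := fun i => hx₀.trans_le (hx i)
  set d : Fin k → ℝ := fun i => x i ^ α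
  have hd0 : ∀ i, 0 < d i := fun i => Real.rpow_pos_of_pos (hx0 i) α
  have hC' : ∀ p q : ℕ, p + q ≤ 2 → ∀ i l, |pderiv₂ K p q (x i) (x l)| ≤ C / (d i * d l) := by
    intro p q hpq i l
    have := hC p q hpq (x i) (x l) (hx i) (hx l)
    rwa [Real.mul_rpow (hx0 i).le (hx0 l).le] at this
  set d' : {i // ¬ i = j} → ℝ := fun i => d i
  have hd'0 : ∀ i, 0 < d' i := fun i => hd0 i
  set P : ℝ := ∏ i, d' i
  have hP0 : 0 < P := Finset.prod_pos fun i _ => hd'0 i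
  have hprod : (∏ i, x i) ^ (2 * α) = (d j * P) ^ 2 := by
    have h₁ : ∏ i, d i = d j * P := Fintype.prod_eq_mul_prod_subtype_ne d j
    rw [← h₁, mul_comm 2 α, Real.rpow_mul (Finset.prod_nonneg fun i _ => (hx0 i).le),
      ← Real.finsetProd_rpow _ _ fun i _ => (hx0 i).le]
    exact_mod_cast Real.rpow_natCast _ 2
  have hM := posSemidef_gramCompl hpos hx0 j
  have hdiag : ∀ i, gramCompl K x j i i ≤ C / (d' i * d' i) := fun i =>
    (le_abs_self _).trans (hC' 0 0 (by norm_num) i i)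
  set E : ℝ := Real.exp (Fintype.card {i // ¬ i = j} * C)
  have hE0 : 0 < E := Real.exp_pos _
  have hcard : (Fintype.card {i // ¬ i = j} : ℝ) ≤ k := by
    exact_mod_cast (Fintype.card_subtype_le _).trans_eq (Fintype.card_fin k)
  have hEk : E ≤ Real.exp C ^ k := by
    rw [← Real.exp_nat_mul]
    exact Real.exp_le_exp.2 (mul_le_mul_of_nonneg_right hcard hC0)
  have hdet : |(gramCompl K x j).det| ≤ E / P ^ 2 := by
    rw [abs_of_nonneg hM.det_nonneg]
    exact hM.det_le_of_diag_le hd'0 hdiag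
  have hadj := hM.abs_adjugate_apply_le_of_diag_le hd'0 hdiag
  have hrow : ∀ i, ∀ m ≤ p, |iteratedDeriv m (fun t => K (x i) t) (x j)| ≤ C / (d i * d j) := by
    intro i m hm
    simpa only [pderiv₂, iteratedDeriv_zero] using hC' 0 m (by omega) i j
  have hmul : ∀ i l, |iteratedDeriv p (fun t => K (x i) t * K (x l) t) (x j)| ≤
      4 * (C / (d i * d j) * (C / (d l * d j))) := by
    intro i l
    have hp' : (p : WithTop ℕ∞) ≤ 2 := by exact_mod_cast hp
    refine (abs_iteratedDeriv_mul_le ((contDiffAt_right_of_pos hK (hx0 i) (hx0 j)).of_le hp')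
      ((contDiffAt_right_of_pos hK (hx0 l) (hx0 j)).of_le hp') (hrow i) (hrow l)).trans ?_
    have h2 : (2 : ℝ) ^ p ≤ 4 := by
      calc (2 : ℝ) ^ p ≤ 2 ^ 2 := pow_le_pow_right₀ (by norm_num) hp
        _ = 4 := by norm_num
    have := hd0 i; have := hd0 j; have := hd0 l
    exact mul_le_mul_of_nonneg_right h2 (by positivity)
  rw [iteratedDeriv_rhoK_update hK hpos hsymm hx0 j (hx0 j) hp, hprod]
  have hdj := hd0 j
  have hterm : ∀ i l : {i // ¬ i = j}, |(gramCompl K x j).adjugate i l *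
      iteratedDeriv p (fun t => K (x i) t * K (x l) t) (x j)| ≤
        E * (4 * C ^ 2) / (d j * P) ^ 2 := by
    intro i l
    have hi := hd'0 i; have hl := hd'0 l
    rw [abs_mul]
    refine (mul_le_mul (hadj i l) (hmul i l) (abs_nonneg _) (by positivity)).trans_eq ?_
    change E * (d' i * d' l) / P ^ 2 * (4 * (C / (d' i * d j) * (C / (d' l * d j)))) = _
    field_simp
  have hsum : |∑ i, ∑ l, (gramCompl K x j).adjugate i l *
      iteratedDeriv p (fun t => K (x i) t * K (x l) t) (x j)| ≤
        k ^ 2 * (E * (4 * C ^ 2) / (d j * P) ^ 2) := by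
    refine (Finset.abs_sum_le_sum_abs _ _).trans ((Finset.sum_le_sum fun i _ =>
      (Finset.abs_sum_le_sum_abs _ _).trans (Finset.sum_le_sum fun l _ => hterm i l)).trans ?_)
    simp only [Finset.sum_const, Finset.card_univ, nsmul_eq_mul]
    rw [← mul_assoc, ← sq]
    exact mul_le_mul_of_nonneg_right (pow_le_pow_left₀ (Nat.cast_nonneg _) hcard 2)
      (by positivity)
  have hcorner : |iteratedDeriv p (fun t => K t t) (x j) * (gramCompl K x j).det| ≤
      E * (4 * C) / (d j * P) ^ 2 := by
    rw [abs_mul]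
    refine (mul_le_mul (abs_iteratedDeriv_kernel_diagonal_le hK hsymm (hx0 j)
      (fun p q hpq => hC' p q hpq j j) hp) hdet (abs_nonneg _) (by positivity)).trans_eq ?_
    field_simp
  calc _ ≤ E * (4 * C) / (d j * P) ^ 2 + k ^ 2 * (E * (4 * C ^ 2) / (d j * P) ^ 2) :=
        (abs_sub _ _).trans (add_le_add hcorner hsum)
    _ = E * (4 * C + k ^ 2 * (4 * C ^ 2)) / (d j * P) ^ 2 := by ring
    _ ≤ (Real.exp C * (16 * (1 + C) ^ 2)) ^ k / (d j * P) ^ 2 := by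
        refine div_le_div_of_nonneg_right ?_ (by positivity)
        rw [mul_pow]
        exact mul_le_mul hEk (four_mul_add_le_pow hC0 hk) (by positivity) (by positivity)

lemma iteratedDeriv_rhoK_update_eq_zero
    (hpos : ∀ (k : ℕ) (x : Fin k → ℝ), (∀ i, 0 < x i) →
      (Matrix.of fun i j => K (x i) (x j)).PosSemidef)
    {k : ℕ} {x : Fin k → ℝ} (hx : ∀ i, 0 < x i) {p : ℕ} (hp : p ≤ 1) {j j' : Fin k}
    (hne : j' ≠ j) (heq : x j = x j') :
    iteratedDeriv p (fun u => rhoK K k (Function.update x j u)) (x j) = 0 := by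
  have hzero : rhoK K k (Function.update x j (x j)) = 0 := by
    rw [Function.update_eq_self]
    exact Matrix.det_zero_of_row_eq hne (by ext l; simp [heq])
  interval_cases p
  · simpa using hzero
  · rw [iteratedDeriv_one]
    refine IsLocalMin.deriv_eq_zero ?_
    filter_upwards [lt_mem_nhds (hx j)] with u hu
    rw [hzero]
    refine (hpos k (Function.update x j u) fun i => ?_).det_nonneg
    rcases eq_or_ne i j with rfl | hi
    · simpa using hu
    · simpa [Function.update_of_ne hi] using hx i

end Kernel

/-- Key estimates for correlation functions: if `K` is `C²` on `(0,∞)²`,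
all matrices `(K(x_i,x_j))` are symmetric positive semidefinite, and the partial derivatives
of order `≤ 2` satisfy `|∂^{p+q}K(x,y)| ≤ C(x₀)/(xy)^α` for some `α > 1/2`, then each
correlation function `ρ_k` is `C²`, satisfies `|∂^p ρ_k/∂x_j^p| ≤ C′(x₀)^k/(x₁⋯x_k)^{2α}`
for `p ≤ 2`, and `∂^p ρ_k/∂x_j^p = 0` for `p ≤ 1` whenever two coordinates coincide. -/
theorem correlation_function_estimates (K : ℝ → ℝ → ℝ)
    (hK : ContDiffOn ℝ 2 (Function.uncurry K) (Set.Ioi 0 ×ˢ Set.Ioi 0))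
    (hpos : ∀ (k : ℕ) (x : Fin k → ℝ), (∀ i, 0 < x i) →
      (Matrix.of fun i j => K (x i) (x j)).PosSemidef)
    (α : ℝ) (hα : 1 / 2 < α)
    (hbound : ∀ x₀ : ℝ, 0 < x₀ → ∃ C : ℝ, ∀ p q : ℕ, p + q ≤ 2 →
      ∀ x y : ℝ, x₀ ≤ x → x₀ ≤ y → |pderiv₂ K p q x y| ≤ C / (x * y) ^ α) :
    (∀ k : ℕ, ContDiffOn ℝ 2 (rhoK K k) {x : Fin k → ℝ | ∀ i, 0 < x i}) ∧
    (∀ x₀ : ℝ, 0 < x₀ → ∃ C' : ℝ, ∀ k : ℕ, 1 ≤ k → ∀ x : Fin k → ℝ, (∀ i, x₀ ≤ x i) →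
      ∀ p : ℕ, p ≤ 2 → ∀ j : Fin k,
        |iteratedDeriv p (fun u => rhoK K k (Function.update x j u)) (x j)| ≤
          C' ^ k / (∏ i, x i) ^ (2 * α)) ∧
    ∀ (k : ℕ) (x : Fin k → ℝ), (∀ i, 0 < x i) → ∀ p : ℕ, p ≤ 1 → ∀ j : Fin k,
      (∃ j' : Fin k, j' ≠ j ∧ x j = x j') →
        iteratedDeriv p (fun u => rhoK K k (Function.update x j u)) (x j) = 0 := by
  have hsymm : ∀ x y, 0 < x → 0 < y → K x y = K y x := by
    intro x y hx hy
    have h := (hpos 2 ![x, y] (by simp [Fin.forall_fin_two, hx, hy])).1.apply 1 0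
    simpa using h
  refine ⟨contDiffOn_rhoK hK, fun x₀ hx₀ => ?_, fun k x hx p hp j ⟨j', hne, heq⟩ =>
    iteratedDeriv_rhoK_update_eq_zero hpos hx hp hne heq⟩
  obtain ⟨C, hC⟩ := hbound x₀ hx₀
  have hC0 : 0 ≤ C := by
    have h := (abs_nonneg _).trans (hC 0 0 (by norm_num) x₀ x₀ le_rfl le_rfl)
    simpa using (le_div_iff₀ (Real.rpow_pos_of_pos (mul_pos hx₀ hx₀) α)).1 h
  exact ⟨_, fun k hk x hx p hp j =>
    abs_iteratedDeriv_rhoK_update_le hK hpos hsymm hC0 hx₀ hC hk hx j hp⟩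
end
end

section
/- Let r ≥ 1 and let M be a real symmetric positive semidefinite 2r × 2r matrix. Then the determinant of the off-diagonal r × r block satisfies |det((M_{i, r+j})_{1≤i,j≤r})| ≤ √(∏_{i=1}^r M_{ii} · ∏_{j=1}^r M_{r+j, r+j}). Equivalently, for a kernel K such that every matrix (K(u_i,u_j))_{i,j} built from finitely many points is symmetric positive semidefinite, |det((K(y_i,z_j))_{1≤i,j≤r})| ≤ √(∏_{i=1}^r K(y_i,y_i) · ∏_{j=1}^r K(z_j,z_j)) for all points y₁,…,y_r, z₁,…,z_r. -/
noncomputable section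

open Complex MeasureTheory Filter Set

/-- **Hadamard's inequality**, for coordinates in an orthonormal basis. -/
theorem OrthonormalBasis.abs_det_inner_le {W : Type*} [NormedAddCommGroup W]
    [InnerProductSpace ℝ W] {n : ℕ} (b : OrthonormalBasis (Fin n) ℝ W) (w : Fin n → W) :
    |Matrix.det (Matrix.of fun i k => inner ℝ (b i) (w k))| ≤ ∏ i, ‖w i‖ := by
  have : Fact (Module.finrank ℝ W = n) :=
    ⟨by simpa using Module.finrank_eq_card_basis b.toBasis⟩
  have h := b.toBasis.orientation.abs_volumeForm_apply_le w
  rw [b.toBasis.orientation.volumeForm_robust' b, Module.Basis.det_apply] at h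
  convert h using 3
  ext i k
  simp [Module.Basis.toMatrix_apply, OrthonormalBasis.repr_apply_apply]

/-- The mixed Gram determinant of two families of vectors vanishes when the second family is
linearly dependent. -/
theorem det_inner_eq_zero_of_not_linearIndependent {E : Type*} [NormedAddCommGroup E]
    [InnerProductSpace ℝ E] {n : ℕ} (x y : Fin n → E) (hy : ¬ LinearIndependent ℝ y) :
    Matrix.det (Matrix.of fun i j => inner ℝ (x i) (y j)) = 0 := by
  rw [Fintype.not_linearIndependent_iff] at hy
  obtain ⟨g, hg, i₀, hi₀⟩ := hy
  refine Matrix.exists_mulVec_eq_zero_iff.mp ⟨g, fun h => hi₀ (congrFun h i₀), ?_⟩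
  ext i
  have h : inner ℝ (x i) (∑ j, g j • y j) = 0 := by rw [hg, inner_zero_right]
  simpa [Matrix.mulVec, dotProduct, inner_sum, real_inner_smul_right, mul_comm] using h

/-- The mixed Gram determinant of two families of vectors is at most the product of their norms. -/
theorem abs_det_inner_le_prod_norm_mul_prod_norm {E : Type*} [NormedAddCommGroup E]
    [InnerProductSpace ℝ E] {n : ℕ} (x y : Fin n → E) :
    |Matrix.det (Matrix.of fun i j => inner ℝ (x i) (y j))| ≤ (∏ i, ‖x i‖) * ∏ j, ‖y j‖ := by
  by_cases hy : LinearIndependent ℝ y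
  swap
  · rw [det_inner_eq_zero_of_not_linearIndependent x y hy, abs_zero]
    positivity
  let W := Submodule.span ℝ (Set.range y)
  have : FiniteDimensional ℝ W := FiniteDimensional.span_of_finite ℝ (Set.finite_range y)
  have hW : Module.finrank ℝ W = n := by simpa using finrank_span_eq_card hy
  let b : OrthonormalBasis (Fin n) ℝ W := (stdOrthonormalBasis ℝ W).reindex (finCongr hW)
  let p : Fin n → W := fun i => W.orthogonalProjectionOnto (x i)
  let q : Fin n → W := fun j => ⟨y j, Submodule.subset_span (Set.mem_range_self j)⟩
  have hfactor : (Matrix.of fun i j => inner ℝ (x i) (y j)) =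
      (Matrix.of fun i k => inner ℝ (b i) (p k)).transpose *
        Matrix.of fun i k => inner ℝ (b i) (q k) := by
    ext i j
    have h : inner ℝ (x i) (y j) = inner ℝ (p i) (q j) :=
      (Submodule.inner_orthogonalProjectionOnto_eq_of_mem_right (q j) (x i)).symm
    simp only [Matrix.mul_apply, Matrix.transpose_apply, Matrix.of_apply]
    rw [h, ← b.sum_inner_mul_inner (p i) (q j)]
    exact Finset.sum_congr rfl fun k _ => by rw [real_inner_comm]
  rw [hfactor, Matrix.det_mul, Matrix.det_transpose, abs_mul]
  have hp : ∏ i, ‖p i‖ ≤ ∏ i, ‖x i‖ :=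
    Finset.prod_le_prod (fun _ _ => norm_nonneg _)
      fun i _ => W.norm_orthogonalProjectionOnto_apply_le (x i)
  have hq : ∏ j, ‖q j‖ = ∏ j, ‖y j‖ := rfl
  rw [← hq]
  exact mul_le_mul ((b.abs_det_inner_le p).trans hp) (b.abs_det_inner_le q)
    (abs_nonneg _) (by positivity)

/-- A real positive semidefinite matrix is a Gram matrix. -/
theorem Matrix.PosSemidef.exists_eq_inner {ι : Type*} [Fintype ι] {M : Matrix ι ι ℝ}
    (hM : M.PosSemidef) :
    ∃ v : ι → EuclideanSpace ℝ ι, ∀ i j, M i j = inner ℝ (v i) (v j) := by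
  classical
  obtain ⟨B, rfl⟩ : ∃ B : Matrix ι ι ℝ, M = B.conjTranspose * B := by
    open scoped MatrixOrder Matrix.Norms.L2Operator in
    exact CStarAlgebra.nonneg_iff_eq_star_mul_self.mp hM.nonneg
  refine ⟨fun i => WithLp.toLp 2 fun k => B k i, fun i j => ?_⟩
  simp [Matrix.mul_apply, PiLp.inner_apply, mul_comm]

/-- The determinant of a square submatrix of a positive semidefinite matrix is bounded by the
geometric mean of the products of the diagonal entries indexed by its rows and its columns. -/
theorem Matrix.PosSemidef.abs_det_submatrix_le {ι : Type*} [Fintype ι] {M : Matrix ι ι ℝ}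
    (hM : M.PosSemidef) {n : ℕ} (f g : Fin n → ι) :
    |Matrix.det (Matrix.of fun i j => M (f i) (g j))| ≤
      Real.sqrt ((∏ i, M (f i) (f i)) * ∏ j, M (g j) (g j)) := by
  obtain ⟨v, hv⟩ := hM.exists_eq_inner
  simp_rw [hv]
  refine (abs_det_inner_le_prod_norm_mul_prod_norm (v ∘ f) (v ∘ g)).trans
    (Real.le_sqrt_of_sq_le (le_of_eq ?_))
  simp [mul_pow, Finset.prod_pow]

/-- Gram-type bound: for a real symmetric positive semidefinite `2r × 2r`
matrix `M`, the determinant of the off-diagonal `r × r` block is bounded by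
`√(∏ M_{ii} ∏ M_{r+j,r+j})`; equivalently, for a positive definite kernel `K`,
`|det(K(y_i,z_j))| ≤ √(∏ K(y_i,y_i) ∏ K(z_j,z_j))`. -/
theorem offdiagonal_block_det_bound (r : ℕ) (hr : 1 ≤ r) :
    (∀ M : Matrix (Fin (r + r)) (Fin (r + r)) ℝ, M.PosSemidef →
      |Matrix.det (Matrix.of fun i j : Fin r => M (Fin.castAdd r i) (Fin.natAdd r j))| ≤
        Real.sqrt ((∏ i : Fin r, M (Fin.castAdd r i) (Fin.castAdd r i)) *
          ∏ j : Fin r, M (Fin.natAdd r j) (Fin.natAdd r j))) ∧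
    ∀ K : ℝ → ℝ → ℝ,
      (∀ (m : ℕ) (u : Fin m → ℝ), (Matrix.of fun i j => K (u i) (u j)).PosSemidef) →
      ∀ y z : Fin r → ℝ,
        |Matrix.det (Matrix.of fun i j => K (y i) (z j))| ≤
          Real.sqrt ((∏ i, K (y i) (y i)) * ∏ j, K (z j) (z j)) := by
  refine ⟨fun M hM => hM.abs_det_submatrix_le _ _, fun K hK y z => ?_⟩
  simpa only [Matrix.of_apply, Fin.append_left, Fin.append_right] using
    (hK (r + r) (Fin.append y z)).abs_det_submatrix_le (Fin.castAdd r) (Fin.natAdd r)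
end
end

section
/- Let ε ∈ {0,1}, h ∈ ℂ, a ∈ (0,∞), and for N ≥ 1 set n := N − ε and F_{n,h,a}(x) := ∑_{k=0}^∞ ((−n)_k (h)_k/((a)_k k!)) (2/(1+ix))^k (a terminating sum since (−n)_k = 0 for k > n). Then x ↦ F_{n,h,a}(Nx) and x ↦ ₁F₁[h,a; 2i/x] are C^∞ from ℝ∖{0} to ℂ; for every p ∈ ℕ and every x ≠ 0, d^p/dx^p (F_{n,h,a}(Nx)) → d^p/dx^p (₁F₁[h,a; 2i/x]) as N → ∞; and for every x₀ > 0 there is a constant C(x₀,h,a,p) such that |d^p/dx^p (F_{n,h,a}(Nx))| ≤ C(x₀,h,a,p)/|x|^{p + 𝟙_{p>0}} for all N ≥ 1 and all x with |x| ≥ x₀, where 𝟙_{p>0} equals 1 if p > 0 and 0 if p = 0. -/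
noncomputable section

open Complex MeasureTheory Filter Set

/-- The Gauss series `₂F₁[−n, h; a; w]`, as a function of its complex argument. -/
def gaussNeg (n : ℕ) (h : ℂ) (a : ℝ) (w : ℂ) : ℂ :=
  ∑' k : ℕ, poch (-(n : ℂ)) k * poch h k / (poch (a : ℂ) k * (k.factorial : ℂ)) * w ^ k

lemma poch_ofReal_ne_zero {a : ℝ} (ha : 0 < a) (k : ℕ) : poch (a : ℂ) k ≠ 0 := by
  refine Finset.prod_ne_zero_iff.2 fun i _ => ?_
  exact_mod_cast (by positivity : a + (i : ℝ) ≠ 0)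

lemma poch_neg_natCast_eq_zero {n k : ℕ} (hk : n < k) : poch (-(n : ℂ)) k = 0 :=
  Finset.prod_eq_zero (Finset.mem_range.2 hk) (by simp)

lemma norm_poch_neg_natCast_le {n N : ℕ} (hn : n ≤ N) (k : ℕ) :
    ‖poch (-(n : ℂ)) k‖ ≤ (N : ℝ) ^ k := by
  rcases lt_or_ge n k with hk | hk
  · rw [poch_neg_natCast_eq_zero hk, norm_zero]
    positivity
  · rw [poch, norm_prod]
    refine (Finset.prod_le_prod (g := fun _ => (N : ℝ)) (fun _ _ => norm_nonneg _)
      fun i hi => ?_).trans_eq (by simp)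
    have hi' : i ≤ n := (Finset.mem_range.1 hi).le.trans hk
    have : -(n : ℂ) + i = -((n - i : ℕ) : ℂ) := by
      rw [Nat.cast_sub hi']
      ring
    rw [this, norm_neg, Complex.norm_natCast]
    exact_mod_cast (Nat.sub_le n i).trans hn

lemma norm_poch_div_poch_le (h : ℂ) {a : ℝ} (ha : 0 < a) (k : ℕ) :
    ‖poch h k / poch (a : ℂ) k‖ ≤ (‖h‖ / a + 1) ^ k := by
  rw [poch, poch, ← Finset.prod_div_distrib, norm_prod]
  refine (Finset.prod_le_prod (g := fun _ => ‖h‖ / a + 1) (fun _ _ => norm_nonneg _)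
    fun i _ => ?_).trans_eq (by simp)
  have hpos : 0 < a + (i : ℝ) := by positivity
  have hden : ‖(a : ℂ) + i‖ = a + i := by
    rw [← Complex.ofReal_natCast, ← Complex.ofReal_add, Complex.norm_real,
      Real.norm_of_nonneg hpos.le]
  rw [norm_div, hden, div_le_iff₀ hpos]
  have h1 : ‖h + i‖ ≤ ‖h‖ + i := (norm_add_le _ _).trans_eq (by simp)
  have h2 : ‖h‖ / a * a = ‖h‖ := div_mul_cancel₀ _ ha.ne'
  have h3 : 0 ≤ ‖h‖ / a * i := by positivity
  nlinarith

lemma norm_gaussNeg_term_le (h : ℂ) {a : ℝ} (ha : 0 < a) {n N : ℕ} (hn : n ≤ N) {w : ℂ} {r : ℝ}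
    (hw : N * ‖w‖ ≤ r) (k : ℕ) :
    ‖poch (-(n : ℂ)) k * poch h k / (poch (a : ℂ) k * (k.factorial : ℂ)) * w ^ k‖ ≤
      ((‖h‖ / a + 1) * r) ^ k / k.factorial := by
  have hsplit : poch (-(n : ℂ)) k * poch h k / (poch (a : ℂ) k * (k.factorial : ℂ)) * w ^ k =
      (poch h k / poch (a : ℂ) k) * (poch (-(n : ℂ)) k * w ^ k) / (k.factorial : ℂ) := by
    field_simp
  rw [hsplit, norm_div, norm_mul, norm_mul, norm_pow, Complex.norm_natCast, mul_pow]
  gcongr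
  · exact norm_poch_div_poch_le h ha k
  · calc ‖poch (-(n : ℂ)) k‖ * ‖w‖ ^ k ≤ (N : ℝ) ^ k * ‖w‖ ^ k := by
          gcongr
          exact norm_poch_neg_natCast_le hn k
      _ = (N * ‖w‖) ^ k := (mul_pow _ _ _).symm
      _ ≤ r ^ k := by gcongr

lemma norm_tsum_sub_one_le_of_le_pow_div_factorial {t : ℕ → ℂ} {s : ℝ}
    (h0 : t 0 = 1) (ht : ∀ k, ‖t k‖ ≤ s ^ k / k.factorial) :
    ‖∑' k, t k - 1‖ ≤ s * Real.exp s := by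
  have hexp : HasSum (fun k : ℕ => s ^ k / k.factorial) (Real.exp s) := by
    rw [Real.exp_eq_exp_ℝ]
    exact NormedSpace.expSeries_div_hasSum_exp s
  have hsum : Summable t := Summable.of_norm_bounded hexp.summable ht
  have htail : HasSum (fun k : ℕ => s ^ (k + 1) / (k + 1).factorial) (Real.exp s - 1) := by
    simpa using (hasSum_nat_add_iff' 1).2 hexp
  have hle : Real.exp s - 1 ≤ s * Real.exp s := by
    have h1 := Real.add_one_le_exp (-s)
    have h2 : Real.exp (-s) * Real.exp s = 1 := by rw [← Real.exp_add]; simp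
    nlinarith [Real.exp_pos s]
  rw [hsum.tsum_eq_zero_add, h0, add_sub_cancel_left]
  exact (tsum_of_norm_bounded htail fun k => ht (k + 1)).trans hle

lemma norm_gaussNeg_sub_one_le (h : ℂ) {a : ℝ} (ha : 0 < a) {n N : ℕ} (hn : n ≤ N) {w : ℂ} {r : ℝ}
    (hw : N * ‖w‖ ≤ r) :
    ‖gaussNeg n h a w - 1‖ ≤ (‖h‖ / a + 1) * r * Real.exp ((‖h‖ / a + 1) * r) :=
  norm_tsum_sub_one_le_of_le_pow_div_factorial (by simp [poch])
    (norm_gaussNeg_term_le h ha hn hw)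

lemma differentiable_gaussNeg (n : ℕ) (h : ℂ) (a : ℝ) : Differentiable ℂ (gaussNeg n h a) := by
  have : gaussNeg n h a = fun w => ∑ k ∈ Finset.range (n + 1),
      poch (-(n : ℂ)) k * poch h k / (poch (a : ℂ) k * (k.factorial : ℂ)) * w ^ k := by
    ext w
    refine tsum_eq_sum fun k hk => ?_
    rw [poch_neg_natCast_eq_zero (by simpa using hk)]
    simp
  rw [this]
  fun_prop

lemma differentiable_oneF1 (h : ℂ) {a : ℝ} (ha : 0 < a) : Differentiable ℂ (oneF1 h (a : ℂ)) := by
  intro z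
  have hd : DifferentiableOn ℂ (oneF1 h (a : ℂ)) (Metric.ball 0 (‖z‖ + 1)) := by
    refine differentiableOn_tsum_of_summable_norm
      (Real.summable_pow_div_factorial ((‖h‖ / a + 1) * (‖z‖ + 1))) (fun k => by fun_prop)
      Metric.isOpen_ball fun k w hw => ?_
    rw [mem_ball_zero_iff] at hw
    rw [← div_div, norm_mul, norm_div, norm_pow, Complex.norm_natCast, mul_pow, mul_div_right_comm]
    gcongr
    exact norm_poch_div_poch_le h ha k
  exact hd.differentiableAt (Metric.isOpen_ball.mem_nhds (by simp))

lemma natCast_mul_norm_two_div_le {N : ℕ} {z : ℂ} {r : ℝ} (hr : 0 < r) (hz : r ≤ |z.re|) :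
    N * ‖2 / (1 + Complex.I * (N * z))‖ ≤ 2 / r := by
  rcases Nat.eq_zero_or_pos N with rfl | hN
  · rw [Nat.cast_zero, zero_mul]
    positivity
  · have hN' : (0 : ℝ) < N := by exact_mod_cast hN
    have him : N * r ≤ ‖1 + Complex.I * (N * z)‖ := by
      refine le_trans ?_ (Complex.abs_im_le_norm _)
      simp only [Complex.add_im, Complex.one_im, Complex.I_mul_im, Complex.mul_re,
        Complex.natCast_re, Complex.natCast_im, zero_mul, sub_zero, zero_add, abs_mul,
        Nat.abs_cast]
      gcongr
    rw [norm_div, Complex.norm_ofNat, mul_div_assoc',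
      div_le_div_iff₀ ((mul_pos hN' hr).trans_le him) hr]
    nlinarith

lemma tendsto_gaussNeg (ε : ℕ) (h : ℂ) {a : ℝ} (ha : 0 < a) {z : ℂ} (hz : z.re ≠ 0) :
    Tendsto (fun N : ℕ => gaussNeg (N - ε) h a (2 / (1 + Complex.I * (N * z)))) atTop
      (nhds (oneF1 h (a : ℂ) (2 * Complex.I / z))) := by
  have hz0 : z ≠ 0 := by
    rintro rfl
    simp at hz
  refine tendsto_tsum_of_dominated_convergence
    (Real.summable_pow_div_factorial ((‖h‖ / a + 1) * (2 / |z.re|))) (fun k => ?_)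
    (Eventually.of_forall fun N k => norm_gaussNeg_term_le h ha (Nat.sub_le N ε)
      (natCast_mul_norm_two_div_le (abs_pos.2 hz) le_rfl) k)
  have hinv : Tendsto (fun N : ℕ => (N : ℂ)⁻¹) atTop (nhds 0) := tendsto_inv_atTop_nhds_zero_nat
  have hfac (i : ℕ) : Tendsto
      (fun N : ℕ => (-((N - ε : ℕ) : ℂ) + i) * (2 / (1 + Complex.I * (N * z)))) atTop
      (nhds (2 * Complex.I / z)) := by
    have hlim : Tendsto (fun N : ℕ => (-1 + (ε + i) * (N : ℂ)⁻¹) *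
        (2 / ((N : ℂ)⁻¹ + Complex.I * z))) atTop
        (nhds ((-1 + (ε + i) * 0) * (2 / (0 + Complex.I * z)))) := by
      refine Tendsto.mul ((hinv.const_mul _).const_add _)
        (tendsto_const_nhds.div (hinv.add_const _) ?_)
      simpa using hz0
    have hval : (-1 + ((ε : ℂ) + i) * 0) * (2 / (0 + Complex.I * z)) = 2 * Complex.I / z := by
      rw [mul_zero, add_zero, zero_add, mul_div_assoc',
        div_eq_div_iff (mul_ne_zero Complex.I_ne_zero hz0) hz0]
      linear_combination (-2 * z) * Complex.I_mul_I
    rw [hval] at hlim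
    refine hlim.congr' ?_
    filter_upwards [eventually_ge_atTop (max 1 ε)] with N hN
    have hN0 : (N : ℂ) ≠ 0 := by
      exact_mod_cast (Nat.lt_of_lt_of_le one_pos ((le_max_left _ _).trans hN)).ne'
    have hden : 1 + Complex.I * (N * z) = N * ((N : ℂ)⁻¹ + Complex.I * z) := by
      field_simp
    have hw : 2 / (1 + Complex.I * (N * z)) = (N : ℂ)⁻¹ * (2 / ((N : ℂ)⁻¹ + Complex.I * z)) := by
      rw [hden, ← div_eq_inv_mul, div_div, mul_comm (N : ℂ)]
    rw [Nat.cast_sub ((le_max_right _ _).trans hN), hw]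
    linear_combination (2 / ((N : ℂ)⁻¹ + Complex.I * z)) * mul_inv_cancel₀ hN0
  have hprod : Tendsto (fun N : ℕ => poch (-((N - ε : ℕ) : ℂ)) k *
      (2 / (1 + Complex.I * (N * z))) ^ k) atTop (nhds ((2 * Complex.I / z) ^ k)) := by
    have := tendsto_finsetProd (Finset.range k) fun i _ => hfac i
    simpa [Finset.prod_mul_distrib, poch, div_pow] using this
  refine (hprod.const_mul (poch h k / (poch (a : ℂ) k * k.factorial))).congr fun N => ?_
  ring

lemma iteratedDeriv_comp_ofReal {f : ℂ → ℂ} {U : Set ℂ} (hU : IsOpen U)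
    (hf : DifferentiableOn ℂ f U) (p : ℕ) {x : ℝ} (hx : (x : ℂ) ∈ U) :
    iteratedDeriv p (fun y : ℝ => f y) x = iteratedDeriv p f x := by
  induction p generalizing f with
  | zero => simp
  | succ p ih =>
    rw [iteratedDeriv_succ', iteratedDeriv_succ', ← ih (hf.deriv hU)]
    refine Filter.EventuallyEq.iteratedDeriv_eq p ?_
    filter_upwards [(hU.preimage Complex.continuous_ofReal).mem_nhds hx] with y hy
    exact (hf.differentiableAt (hU.mem_nhds hy)).hasDerivAt.comp_ofReal.deriv

lemma contDiffOn_comp_ofReal {f : ℂ → ℂ} {U : Set ℂ} (hU : IsOpen U)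
    (hf : DifferentiableOn ℂ f U) (n : WithTop ℕ∞) :
    ContDiffOn ℝ n (fun y : ℝ => f y) (Complex.ofReal ⁻¹' U) :=
  ((hf.contDiffOn hU).restrict_scalars ℝ).comp Complex.ofRealCLM.contDiff.contDiffOn
    (fun _ hx => hx)

/-- Pointwise convergence of uniformly bounded holomorphic functions on a closed disc implies
convergence of all derivatives at its center. -/
lemma tendsto_iteratedDeriv_of_bounded {F : ℕ → ℂ → ℂ} {f : ℂ → ℂ} {c : ℂ} {R M : ℝ} (hR : 0 < R)
    (hF : ∀ N, DifferentiableOn ℂ (F N) (Metric.closedBall c R))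
    (hf : DifferentiableOn ℂ f (Metric.closedBall c R))
    (hM : ∀ N, ∀ z ∈ Metric.sphere c R, ‖F N z‖ ≤ M)
    (hlim : ∀ z ∈ Metric.sphere c R, Tendsto (fun N => F N z) atTop (nhds (f z))) (p : ℕ) :
    Tendsto (fun N => iteratedDeriv p (F N) c) atTop (nhds (iteratedDeriv p f c)) := by
  have hconst : (2 * Real.pi * Complex.I / p.factorial : ℂ) ≠ 0 := by
    simp [Real.pi_ne_zero, Nat.factorial_ne_zero]
  have hcauchy {g : ℂ → ℂ} (hg : DifferentiableOn ℂ g (Metric.closedBall c R)) :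
      iteratedDeriv p g c = (2 * Real.pi * Complex.I / p.factorial : ℂ)⁻¹ *
        ∮ z in C(c, R), (1 / (z - c) ^ (p + 1)) • g z := by
    rw [hg.circleIntegral_one_div_sub_center_pow_smul hR p, smul_eq_mul,
      inv_mul_cancel_left₀ hconst]
  rw [hcauchy hf]
  simp_rw [fun N => hcauchy (hF N)]
  refine Tendsto.const_mul _ ?_
  have hmem (θ : ℝ) : circleMap c R θ ∈ Metric.sphere c R := circleMap_mem_sphere c hR.le θ
  refine intervalIntegral.tendsto_integral_filter_of_dominated_convergence
    (fun _ => R * (1 / R ^ (p + 1) * M)) (Eventually.of_forall fun N => ?_)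
    (Eventually.of_forall fun N => Eventually.of_forall fun θ _ => ?_)
    intervalIntegrable_const (Eventually.of_forall fun θ _ => ?_)
  · have hcont : Continuous fun θ : ℝ => F N (circleMap c R θ) :=
      (hF N).continuousOn.comp_continuous (continuous_circleMap c R)
        fun θ => Metric.sphere_subset_closedBall (hmem θ)
    have hne (θ : ℝ) : (circleMap c R θ - c) ^ (p + 1) ≠ 0 :=
      pow_ne_zero _ (sub_ne_zero.2 (circleMap_ne_center hR.ne'))
    have hden : Continuous fun θ : ℝ => 1 / (circleMap c R θ - c) ^ (p + 1) :=
      continuous_const.div (((continuous_circleMap c R).sub continuous_const).pow _) hne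
    have hderiv : Continuous (deriv (circleMap c R)) := by
      simp only [funext (deriv_circleMap c R)]
      fun_prop
    exact (hderiv.smul (hden.smul hcont)).aestronglyMeasurable
  · have hsub : ‖circleMap c R θ - c‖ = R := mem_sphere_iff_norm.1 (hmem θ)
    have := hM N _ (hmem θ)
    rw [norm_smul, norm_smul, norm_div, norm_pow, hsub, norm_one, deriv_circleMap]
    simp only [norm_mul, norm_circleMap_zero, abs_of_pos hR, Complex.norm_I, mul_one]
    gcongr
  · exact ((hlim _ (hmem θ)).const_smul _).const_smul _

/-- For `ε ∈ {0,1}`, `h ∈ ℂ`, `a > 0` and `n := N − ε`, the functions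
`x ↦ F_{n,h,a}(Nx)` and `x ↦ ₁F₁[h,a;2i/x]` are `C^∞` on `ℝ∖{0}`, the `p`-th derivative of
the former converges pointwise to that of the latter as `N → ∞`, and
`|d^p/dx^p F_{n,h,a}(Nx)| ≤ C(x₀,h,a,p)/|x|^{p + 𝟙_{p>0}}` for `|x| ≥ x₀ > 0`. -/
theorem Fnha_derivatives_converge (ε : ℕ) (hε : ε ≤ 1) (h : ℂ) (a : ℝ) (ha : 0 < a) :
    (∀ N : ℕ, 1 ≤ N →
      ContDiffOn ℝ (⊤ : ℕ∞) (fun x : ℝ => Fnha (N - ε) h a ((N : ℝ) * x)) {0}ᶜ) ∧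
    ContDiffOn ℝ (⊤ : ℕ∞) (fun x : ℝ => oneF1 h (a : ℂ) (2 * Complex.I / (x : ℂ))) {0}ᶜ ∧
    (∀ p : ℕ, ∀ x : ℝ, x ≠ 0 →
      Filter.Tendsto
        (fun N : ℕ => iteratedDeriv p (fun x' : ℝ => Fnha (N - ε) h a ((N : ℝ) * x')) x)
        Filter.atTop
        (nhds (iteratedDeriv p (fun x' : ℝ => oneF1 h (a : ℂ) (2 * Complex.I / (x' : ℂ))) x))) ∧
    ∀ p : ℕ, ∀ x₀ : ℝ, 0 < x₀ → ∃ C : ℝ, ∀ N : ℕ, 1 ≤ N → ∀ x : ℝ, x₀ ≤ |x| →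
      ‖iteratedDeriv p (fun x' : ℝ => Fnha (N - ε) h a ((N : ℝ) * x')) x‖ ≤
        C / |x| ^ (p + if 0 < p then 1 else 0) := by
  set U : Set ℂ := {z | z.re ≠ 0} with hUdef
  have hU : IsOpen U := isOpen_ne_fun Complex.continuous_re continuous_const
  have hpre : Complex.ofReal ⁻¹' U = ({0}ᶜ : Set ℝ) := by
    ext x
    simp [hUdef]
  set G : ℕ → ℂ → ℂ := fun N z => gaussNeg (N - ε) h a (2 / (1 + Complex.I * (N * z))) with hG
  set g : ℂ → ℂ := fun z => oneF1 h (a : ℂ) (2 * Complex.I / z) with hg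
  have hFG (N : ℕ) : (fun x : ℝ => Fnha (N - ε) h a ((N : ℝ) * x)) = fun x : ℝ => G N x := by
    ext x
    simp [hG, gaussNeg, Fnha]
  have hGd (N : ℕ) : DifferentiableOn ℂ (G N) U := by
    intro z hz
    have hne : 1 + Complex.I * (N * z) ≠ 0 := by
      intro h0
      have him := congrArg Complex.im h0
      have hre := congrArg Complex.re h0
      rcases (by simpa using him : N = 0 ∨ z.re = 0) with rfl | h1
      · simp at hre
      · exact hz h1
    exact ((differentiable_gaussNeg _ h a _).comp z
      (by fun_prop (disch := exact hne))).differentiableWithinAt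
  have hgd : DifferentiableOn ℂ g U := by
    intro z hz
    have hne : z ≠ 0 := by
      rintro rfl
      exact hz rfl
    exact ((differentiable_oneF1 h ha _).comp z
      (by fun_prop (disch := exact hne))).differentiableWithinAt
  have hre {x : ℝ} {z : ℂ} (hz : z ∈ Metric.closedBall (x : ℂ) (|x| / 2)) :
      |x| / 2 ≤ |z.re| := by
    have h1 : |z.re - x| ≤ |x| / 2 := by
      simpa using (Complex.abs_re_le_norm (z - x)).trans (mem_closedBall_iff_norm.1 hz)
    have h2 := abs_sub_abs_le_abs_sub x z.re
    rw [abs_sub_comm] at h2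
    linarith
  have hsub {x : ℝ} (hx : x ≠ 0) : Metric.closedBall (x : ℂ) (|x| / 2) ⊆ U := fun z hz =>
    abs_pos.1 ((half_pos (abs_pos.2 hx)).trans_le (hre hz))
  have hmem {x : ℝ} (hx : x ≠ 0) : (x : ℂ) ∈ U := by simpa [hUdef] using hx
  set K : ℝ := ‖h‖ / a + 1
  have hK : 0 ≤ K := by positivity
  have hbd {x : ℝ} (hx : x ≠ 0) (N : ℕ) {z : ℂ} (hz : z ∈ Metric.closedBall (x : ℂ) (|x| / 2)) :
      ‖G N z - 1‖ ≤ K * (4 / |x|) * Real.exp (K * (4 / |x|)) := by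
    refine norm_gaussNeg_sub_one_le h ha (Nat.sub_le N ε)
      ((natCast_mul_norm_two_div_le (half_pos (abs_pos.2 hx)) (hre hz)).trans_eq ?_)
    rw [div_div_eq_mul_div]
    norm_num
  refine ⟨fun N _ => ?_, ?_, fun p x hx => ?_, fun p x₀ hx₀ => ?_⟩
  · rw [hFG, ← hpre]
    exact contDiffOn_comp_ofReal hU (hGd N) _
  · rw [← hpre]
    exact contDiffOn_comp_ofReal hU hgd _
  · rw [iteratedDeriv_comp_ofReal hU hgd p (hmem hx)]
    simp_rw [hFG, fun N => iteratedDeriv_comp_ofReal hU (hGd N) p (hmem hx)]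
    refine tendsto_iteratedDeriv_of_bounded (half_pos (abs_pos.2 hx))
      (M := K * (4 / |x|) * Real.exp (K * (4 / |x|)) + 1)
      (fun N => (hGd N).mono (hsub hx)) (hgd.mono (hsub hx)) (fun N z hz => ?_)
      (fun z hz => tendsto_gaussNeg ε h ha (hsub hx (Metric.sphere_subset_closedBall hz))) p
    have h1 := hbd hx N (Metric.sphere_subset_closedBall hz)
    have h2 := norm_add_le (G N z - 1) 1
    rw [sub_add_cancel, norm_one] at h2
    linarith
  · set E : ℝ := Real.exp (K * (4 / x₀))
    have hbd' {x : ℝ} (hx : x₀ ≤ |x|) (N : ℕ) {z : ℂ}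
        (hz : z ∈ Metric.closedBall (x : ℂ) (|x| / 2)) : ‖G N z - 1‖ ≤ K * (4 / |x|) * E :=
      (hbd (abs_pos.1 (hx₀.trans_le hx)) N hz).trans
        (mul_le_mul_of_nonneg_left (Real.exp_le_exp.2 (by gcongr)) (by positivity))
    rcases Nat.eq_zero_or_pos p with rfl | hp
    · refine ⟨K * (4 / x₀) * E + 1, fun N _ x hx => ?_⟩
      have hxpos : 0 < |x| := hx₀.trans_le hx
      have h1 := hbd' hx N (Metric.mem_closedBall_self (half_pos hxpos).le)
      have h2 := norm_add_le (G N x - 1) 1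
      have h3 : K * (4 / |x|) * E ≤ K * (4 / x₀) * E := by gcongr
      rw [sub_add_cancel, norm_one] at h2
      rw [hFG]
      simp only [iteratedDeriv_zero, lt_irrefl, if_false, add_zero, pow_zero, div_one]
      linarith
    · refine ⟨p.factorial * (4 * K * E) * 2 ^ p, fun N _ x hx => ?_⟩
      have hxpos : 0 < |x| := hx₀.trans_le hx
      have hx0 : x ≠ 0 := abs_pos.1 hxpos
      rw [hFG, iteratedDeriv_comp_ofReal hU (hGd N) p (hmem hx0), if_pos hp]
      have hshift : iteratedDeriv p (fun z => G N z - 1) x = iteratedDeriv p (G N) x := by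
        obtain ⟨q, rfl⟩ := Nat.exists_eq_succ_of_ne_zero hp.ne'
        simp only [Nat.succ_eq_add_one, iteratedDeriv_succ', deriv_sub_const_fun]
      rw [← hshift]
      have hd : DifferentiableOn ℂ (fun z => G N z - 1) (Metric.closedBall (x : ℂ) (|x| / 2)) :=
        ((hGd N).mono (hsub hx0)).sub_const 1
      refine (Complex.norm_iteratedDeriv_le_of_forall_mem_sphere_norm_le p (half_pos hxpos)
        (hd.diffContOnCl_ball subset_rfl)
        fun z hz => hbd' hx N (Metric.sphere_subset_closedBall hz)).trans_eq ?_
      rw [pow_succ, div_pow]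
      field_simp
end
end

section
/- Let f and g be C^∞ functions from ℝ∖{0} to ℝ, and define φ on (ℝ∖{0})² by φ(x,y) = (f(x)g(y) − g(x)f(y))/(x − y) for x ≠ y and φ(x,x) = f′(x)g(x) − g′(x)f(x). Then φ is C^∞ on (ℝ∖{0})², and for all p,q ∈ ℕ and all x ≠ y in ℝ∖{0}: ∂^{p+q}φ/∂x^p∂y^q (x,y) = ∑_{k=0}^p ∑_{l=0}^q binom(p,k)·binom(q,l) · ((f^{(k)}(x)g^{(l)}(y) − g^{(k)}(x)f^{(l)}(y))/(x−y)^{p+q−k−l+1}) · (−1)^{p−k} · (p+q−k−l)!. -/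
noncomputable section

open Complex MeasureTheory Filter Set

section SmoothParametricIntegrals

variable {P : Type*} [NormedAddCommGroup P] [NormedSpace ℝ P]

/-- The integral of a smooth function over a compact interval depends smoothly on parameters. -/
theorem contDiff_intervalIntegral_of_contDiff_uncurry {h : P → ℝ → ℝ}
    (hh : ContDiff ℝ (⊤ : ℕ∞) (Function.uncurry h)) (a b : ℝ) :
    ContDiff ℝ (⊤ : ℕ∞) (fun p => ∫ t in a..b, h p t) := by
  wlog hab : a ≤ b generalizing a b
  · simp_rw [intervalIntegral.integral_symm b a]
    exact (this b a (le_of_not_ge hab)).neg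
  let χ : ContDiffBump (0 : ℝ) :=
    ⟨|a| + |b| + 1, |a| + |b| + 2, by positivity, by linarith⟩
  let u : ℝ → ℝ := (Ioc a b).indicator 1
  let g : P → ℝ → ℝ := fun p s => χ (-s) * h p (-s)
  have hg : ContDiffOn ℝ (⊤ : ℕ∞) (Function.uncurry g) (univ ×ˢ univ) := by
    refine ContDiff.contDiffOn ?_
    refine ContDiff.mul (χ.contDiff.comp contDiff_snd.neg)
      (hh.comp (contDiff_fst.prodMk contDiff_snd.neg))
  have hu : LocallyIntegrable u volume :=
    (integrable_indicator_iff measurableSet_Ioc |>.2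
      (integrableOn_const (by simp))).locallyIntegrable
  have key := contDiffOn_convolution_right_with_param_comp (μ := volume)
    (ContinuousLinearMap.lsmul ℝ ℝ) (g := g) (v := fun _ : P => (0 : ℝ)) contDiffOn_const
    isOpen_univ (isCompact_closedBall (0 : ℝ) (|a| + |b| + 2))
    (fun p s _ hs => by
      rw [mem_closedBall_zero_iff, not_le] at hs
      have : χ (-s) = 0 := χ.zero_of_le_dist (by simpa [χ] using hs.le)
      simp [g, this]) hu hg
  rw [contDiffOn_univ] at key
  convert key using 2 with p
  rw [intervalIntegral.integral_of_le hab, ← integral_indicator measurableSet_Ioc]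
  refine integral_congr_ae (Eventually.of_forall fun t => ?_)
  by_cases ht : t ∈ Ioc a b
  · have : χ t = 1 := χ.one_of_mem_closedBall (by
      simp only [χ, mem_closedBall_zero_iff, Real.norm_eq_abs, abs_le]
      constructor <;> linarith [ht.1, ht.2, neg_abs_le a, le_abs_self b, abs_nonneg a, abs_nonneg b])
    simp [u, g, ht, this]
  · simp [u, ht]

end SmoothParametricIntegrals

/-- Hadamard's lemma: the difference quotient of a smooth function is jointly smooth. -/
theorem ContDiff.exists_smooth_differenceQuotient {F : ℝ → ℝ} (hF : ContDiff ℝ (⊤ : ℕ∞) F) :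
    ∃ D : ℝ × ℝ → ℝ, ContDiff ℝ (⊤ : ℕ∞) D ∧ (∀ x, D (x, x) = deriv F x) ∧
      ∀ x y, F x - F y = (x - y) * D (x, y) := by
  have hF' : ContDiff ℝ (⊤ : ℕ∞) (deriv F) := hF.iterate_deriv 1
  refine ⟨fun p => ∫ t in (0 : ℝ)..1, deriv F (p.2 + (p.1 - p.2) * t),
    contDiff_intervalIntegral_of_contDiff_uncurry
      (h := fun (p : ℝ × ℝ) t => deriv F (p.2 + (p.1 - p.2) * t)) (hF'.comp (by fun_prop)) 0 1,
    by simp, fun x y => ?_⟩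
  have := intervalIntegral.mul_integral_comp_add_mul (a := 0) (b := 1) (f := deriv F) (x - y) y
  rw [this, intervalIntegral.integral_deriv_eq_sub
    (fun z _ => (hF.differentiable (by simp)).differentiableAt)
    (hF'.continuous.intervalIntegrable _ _)]
  simp

/-- A function smooth on an open set is locally the restriction of a globally smooth function. -/
theorem exists_contDiff_eventuallyEq_of_contDiffOn {f : ℝ → ℝ} {U : Set ℝ}
    (hf : ContDiffOn ℝ (⊤ : ℕ∞) f U) (hU : IsOpen U) {x : ℝ} (hx : x ∈ U) :
    ∃ F : ℝ → ℝ, ContDiff ℝ (⊤ : ℕ∞) F ∧ F =ᶠ[nhds x] f := by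
  obtain ⟨r, hr, hrU⟩ := Metric.isOpen_iff.1 hU x hx
  let χ : ContDiffBump x := ⟨r / 4, r / 2, by positivity, by linarith⟩
  refine ⟨fun z => χ z * f z, contDiff_iff_contDiffAt.2 fun z => ?_, ?_⟩
  · by_cases hz : z ∈ U
    · exact χ.contDiff.contDiffAt.mul (hf.contDiffAt (hU.mem_nhds hz))
    · have hz' : r / 2 < dist z x := by
        by_contra! h
        exact hz (hrU (Metric.mem_ball.2 (by linarith)))
      refine (contDiffAt_const (c := (0 : ℝ))).congr_of_eventuallyEq ?_
      filter_upwards [(isOpen_lt continuous_const (continuous_id.dist continuous_const)).mem_nhds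
        hz'] with w hw
      simp [χ.zero_of_le_dist (show χ.rOut ≤ dist w x from le_of_lt hw)]
  · filter_upwards [χ.eventuallyEq_one] with z hz
    simp [hz]

theorem phiFG_contDiffOn {f g : ℝ → ℝ} {U : Set ℝ} (hU : IsOpen U)
    (hf : ContDiffOn ℝ (⊤ : ℕ∞) f U) (hg : ContDiffOn ℝ (⊤ : ℕ∞) g U) :
    ContDiffOn ℝ (⊤ : ℕ∞) (Function.uncurry (phiFG f g)) (U ×ˢ U) := by
  rintro ⟨x, y⟩ ⟨hx, hy⟩
  refine ContDiffAt.contDiffWithinAt ?_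
  by_cases hxy : x = y
  · subst hxy
    obtain ⟨F, hF, hFf⟩ := exists_contDiff_eventuallyEq_of_contDiffOn hf hU hx
    obtain ⟨G, hG, hGg⟩ := exists_contDiff_eventuallyEq_of_contDiffOn hg hU hx
    obtain ⟨D, hD, hDd, hDs⟩ := hF.exists_smooth_differenceQuotient
    obtain ⟨E, hE, hEd, hEs⟩ := hG.exists_smooth_differenceQuotient
    have hsm : ContDiff ℝ (⊤ : ℕ∞) (fun p : ℝ × ℝ => D p * G p.2 - E p * F p.2) :=
      (hD.mul (hG.comp contDiff_snd)).sub (hE.mul (hF.comp contDiff_snd))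
    refine hsm.contDiffAt.congr_of_eventuallyEq ?_
    have h₁ := hFf.eventuallyEq_nhds
    have h₂ := hGg.eventuallyEq_nhds
    filter_upwards [prod_mem_nhds (h₁.and h₂) (hFf.and hGg)] with ⟨z, w⟩ ⟨⟨hz₁, hz₂⟩, hw₁, hw₂⟩
    simp only at hz₁ hz₂ hw₁ hw₂
    simp only [Function.uncurry, phiFG]
    split_ifs with hzw
    · subst hzw
      rw [hDd, hEd, hz₁.deriv_eq, hz₂.deriv_eq, hw₁, hw₂]
    · rw [div_eq_iff (sub_ne_zero.2 hzw), ← hz₁.self_of_nhds, ← hz₂.self_of_nhds, ← hw₁, ← hw₂]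
      linear_combination G w * hDs z w - F w * hEs z w
  · have hfx := hf.contDiffAt (hU.mem_nhds hx)
    have hgx := hg.contDiffAt (hU.mem_nhds hx)
    have hfy := hf.contDiffAt (hU.mem_nhds hy)
    have hgy := hg.contDiffAt (hU.mem_nhds hy)
    have hsm : ContDiffAt ℝ (⊤ : ℕ∞)
        (fun p : ℝ × ℝ => (f p.1 * g p.2 - g p.1 * f p.2) / (p.1 - p.2)) (x, y) :=
      (((hfx.comp (x, y) contDiffAt_fst).mul (hgy.comp (x, y) contDiffAt_snd)).sub
        ((hgx.comp (x, y) contDiffAt_fst).mul (hfy.comp (x, y) contDiffAt_snd))).div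
        (contDiffAt_fst.sub contDiffAt_snd) (sub_ne_zero.2 hxy)
    refine hsm.congr_of_eventuallyEq ?_
    filter_upwards [(isOpen_ne_fun continuous_fst continuous_snd).mem_nhds
      (show ((x, y) : ℝ × ℝ).1 ≠ (x, y).2 from hxy)] with p hp
    exact if_neg hp

theorem iteratedDeriv_inv_sub_pow_succ (y : ℝ) (m n : ℕ) {x : ℝ} (hx : x ≠ y) :
    iteratedDeriv n (fun z => ((z - y) ^ (m + 1))⁻¹) x =
      (-1) ^ n * ((m + n).factorial / m.factorial : ℝ) / (x - y) ^ (m + n + 1) := by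
  induction n generalizing x with
  | zero =>
    have : (m.factorial : ℝ) ≠ 0 := by positivity
    simp [this]
  | succ n ih =>
    have hxy := sub_ne_zero.2 hx
    rw [iteratedDeriv_succ, EventuallyEq.deriv_eq (f := fun z =>
      (-1) ^ n * ((m + n).factorial / m.factorial : ℝ) / (z - y) ^ (m + n + 1))]
    · have h := ((((hasDerivAt_id x).sub_const y).pow (m + n + 1)).inv
        (pow_ne_zero _ hxy)).const_mul ((-1) ^ n * ((m + n).factorial / m.factorial : ℝ))
      refine (h.congr_deriv ?_).deriv
      rw [← add_assoc m n 1, Nat.factorial_succ]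
      simp only [id, Pi.pow_apply, Nat.add_sub_cancel]
      push_cast
      field_simp
      ring
    · filter_upwards [isOpen_ne.mem_nhds hx] with z hz using ih hz

theorem iteratedDeriv_inv_const_sub (x : ℝ) (n : ℕ) {y : ℝ} (hxy : x ≠ y) :
    iteratedDeriv n (fun z => (x - z)⁻¹) y = n.factorial / (x - y) ^ (n + 1) := by
  have h := congrFun (iteratedDeriv_comp_const_sub n (fun z : ℝ => z⁻¹) x) y
  have h' := iteratedDeriv_inv_sub_pow_succ 0 0 n (sub_ne_zero.2 hxy)
  simp only [sub_zero, zero_add, pow_one] at h'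
  rw [h, h', smul_eq_mul, mul_div_assoc, ← mul_assoc, ← mul_pow]
  simp

theorem iteratedDeriv_phiFG_right {f g : ℝ → ℝ} {x y : ℝ} (q : ℕ) (hxy : x ≠ y)
    (hf : ContDiffAt ℝ q f y) (hg : ContDiffAt ℝ q g y) :
    iteratedDeriv q (fun z => phiFG f g x z) y =
      ∑ l ∈ Finset.range (q + 1), (q.choose l : ℝ) * (q - l).factorial *
        ((f x * iteratedDeriv l g y - g x * iteratedDeriv l f y) *
          ((x - y) ^ (q - l + 1))⁻¹) := by
  have hev : (fun z => phiFG f g x z) =ᶠ[nhds y]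
      (fun z => f x * g z - g x * f z) * fun z => (x - z)⁻¹ := by
    filter_upwards [isOpen_ne.mem_nhds hxy.symm] with z hz
    simp [phiFG, hz.symm, div_eq_mul_inv]
  have hn : ContDiffAt ℝ q (fun z => f x * g z - g x * f z) y :=
    (contDiffAt_const.mul hg).sub (contDiffAt_const.mul hf)
  have hd : ContDiffAt ℝ q (fun z => (x - z)⁻¹) y :=
    (contDiffAt_const.sub contDiffAt_id).inv (sub_ne_zero.2 hxy)
  rw [hev.iteratedDeriv_eq, iteratedDeriv_mul hn hd]
  refine Finset.sum_congr rfl fun l hl => ?_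
  have hlq : (l : WithTop ℕ∞) ≤ q := by
    exact_mod_cast Finset.mem_range_succ_iff.1 hl
  rw [iteratedDeriv_inv_const_sub x _ hxy,
    iteratedDeriv_fun_sub (contDiffAt_const.mul (hg.of_le hlq))
      (contDiffAt_const.mul (hf.of_le hlq)),
    iteratedDeriv_const_mul_field, iteratedDeriv_const_mul_field]
  ring

theorem pderiv₂_phiFG {f g : ℝ → ℝ} {x y : ℝ} (p q : ℕ) (hxy : x ≠ y)
    (hfx : ContDiffAt ℝ p f x) (hgx : ContDiffAt ℝ p g x)
    (hfy : ContDiffAt ℝ q f y) (hgy : ContDiffAt ℝ q g y) :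
    pderiv₂ (phiFG f g) p q x y =
      ∑ k ∈ Finset.range (p + 1), ∑ l ∈ Finset.range (q + 1),
        (p.choose k : ℝ) * (q.choose l : ℝ) *
          ((iteratedDeriv k f x * iteratedDeriv l g y -
              iteratedDeriv k g x * iteratedDeriv l f y) /
            (x - y) ^ (p + q - k - l + 1)) *
          (-1 : ℝ) ^ (p - k) * ((p + q - k - l).factorial : ℝ) := by
  have hev : (fun z => iteratedDeriv q (fun w => phiFG f g z w) y) =ᶠ[nhds x]
      fun z => ∑ l ∈ Finset.range (q + 1), (q.choose l : ℝ) * (q - l).factorial *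
        ((f z * iteratedDeriv l g y - g z * iteratedDeriv l f y) *
          ((z - y) ^ (q - l + 1))⁻¹) := by
    filter_upwards [isOpen_ne.mem_nhds hxy] with z hz
    exact iteratedDeriv_phiFG_right q hz hfy hgy
  have hn (l : ℕ) : ContDiffAt ℝ p
      (fun z => f z * iteratedDeriv l g y - g z * iteratedDeriv l f y) x :=
    (hfx.mul contDiffAt_const).sub (hgx.mul contDiffAt_const)
  have hd (l : ℕ) : ContDiffAt ℝ p (fun z => ((z - y) ^ (q - l + 1))⁻¹) x :=
    ((contDiffAt_id.sub contDiffAt_const).pow _).inv (pow_ne_zero _ (sub_ne_zero.2 hxy))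
  rw [pderiv₂, hev.iteratedDeriv_eq,
    iteratedDeriv_fun_sum fun l _ => contDiffAt_const.mul ((hn l).mul (hd l)), Finset.sum_comm]
  refine Finset.sum_congr rfl fun l hl => ?_
  rw [iteratedDeriv_const_mul_field, iteratedDeriv_fun_mul (hn l) (hd l), Finset.mul_sum]
  refine Finset.sum_congr rfl fun k hk => ?_
  have hlq := Finset.mem_range_succ_iff.1 hl
  have hkp := Finset.mem_range_succ_iff.1 hk
  have hkp' : (k : WithTop ℕ∞) ≤ p := by exact_mod_cast hkp
  have hsum : p + q - k - l = q - l + (p - k) := by omega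
  rw [iteratedDeriv_inv_sub_pow_succ y _ _ hxy,
    iteratedDeriv_fun_sub ((hfx.of_le hkp').mul contDiffAt_const)
      ((hgx.of_le hkp').mul contDiffAt_const),
    iteratedDeriv_mul_const_field, iteratedDeriv_mul_const_field, hsum]
  field_simp

/-- For `f, g` `C^∞` on `ℝ∖{0}`, the function
`φ(x,y) = (f(x)g(y) − g(x)f(y))/(x−y)` (extended to the diagonal by
`φ(x,x) = f′(x)g(x) − g′(x)f(x)`) is `C^∞` on `(ℝ∖{0})²`, with, for `x ≠ y`,
`∂^{p+q}φ/∂x^p∂y^q = ∑_{k≤p} ∑_{l≤q} C_p^k C_q^l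
(f^{(k)}(x)g^{(l)}(y) − g^{(k)}(x)f^{(l)}(y))/(x−y)^{p+q−k−l+1} · (−1)^{p−k}(p+q−k−l)!`. -/
theorem phiFG_smooth_and_offdiag_formula (f g : ℝ → ℝ)
    (hf : ContDiffOn ℝ (⊤ : ℕ∞) f {0}ᶜ) (hg : ContDiffOn ℝ (⊤ : ℕ∞) g {0}ᶜ) :
    ContDiffOn ℝ (⊤ : ℕ∞) (Function.uncurry (phiFG f g)) ({0}ᶜ ×ˢ {0}ᶜ) ∧
    ∀ p q : ℕ, ∀ x y : ℝ, x ≠ 0 → y ≠ 0 → x ≠ y →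
      pderiv₂ (phiFG f g) p q x y =
        ∑ k ∈ Finset.range (p + 1), ∑ l ∈ Finset.range (q + 1),
          (p.choose k : ℝ) * (q.choose l : ℝ) *
            ((iteratedDeriv k f x * iteratedDeriv l g y -
                iteratedDeriv k g x * iteratedDeriv l f y) /
              (x - y) ^ (p + q - k - l + 1)) *
            (-1 : ℝ) ^ (p - k) * ((p + q - k - l).factorial : ℝ) := by
  refine ⟨phiFG_contDiffOn isOpen_compl_singleton hf hg, fun p q x y hx hy hxy => ?_⟩
  have hf' {z : ℝ} (hz : z ≠ 0) (n : ℕ) : ContDiffAt ℝ n f z :=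
    (hf.contDiffAt (isOpen_compl_singleton.mem_nhds hz)).of_le (by exact_mod_cast le_top)
  have hg' {z : ℝ} (hz : z ≠ 0) (n : ℕ) : ContDiffAt ℝ n g z :=
    (hg.contDiffAt (isOpen_compl_singleton.mem_nhds hz)).of_le (by exact_mod_cast le_top)
  exact pderiv₂_phiFG p q hxy (hf' hx p) (hg' hx p) (hf' hy q) (hg' hy q)
end
end
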